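/- arXiv:0903.2593 — 11 statements merged into one kernel-verified Lean document; each statement's English description precedes it below -/
import Mathlib

section
/- Let A be a distributive lattice with least element 0. Then A is a generalized Boolean pseudolattice, i.e. for all a, b, c ∈ A with b ≤ a ≤ c there exists x ∈ A with a ∧ x = b and a ∨ x = c, if and only if every principal ideal ↓(a) = {b ∈ A | b ≤ a} of A is simple. -/
/-- The pseudocomplement of a set `J` in a distributive lattice with least element:
`¬J = {a | a ⊓ b = ⊥ for all b ∈ J}`. -/
def pseudoCompl {A : Type*} [DistribLattice A] [OrderBot A] (J : Set A) : Set A :=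
  {a : A | ∀ b ∈ J, a ⊓ b = ⊥}

/-- An ideal `J` is simple if every element of the lattice is the join of an element
of `J` and an element of `¬J`. -/
def IsSimpleSet {A : Type*} [DistribLattice A] [OrderBot A] (J : Set A) : Prop :=
  ∀ c : A, ∃ a ∈ J, ∃ b ∈ pseudoCompl J, c = a ⊔ b

/-- A distributive lattice with `⊥` is a generalized Boolean pseudolattice iff every
principal ideal is simple. -/
theorem stmt1 {A : Type*} [DistribLattice A] [OrderBot A] :
    (∀ a b c : A, b ≤ a → a ≤ c → ∃ x : A, a ⊓ x = b ∧ a ⊔ x = c) ↔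
      ∀ a : A, IsSimpleSet {b : A | b ≤ a} := by
  constructor
  · intro h a c
    obtain ⟨x, hinf, hsup⟩ := h a ⊥ (a ⊔ c) bot_le le_sup_left
    refine ⟨c ⊓ a, inf_le_right, c ⊓ x, fun b hb => ?_, ?_⟩
    · rw [← le_bot_iff, ← hinf, inf_comm a x]
      exact inf_le_inf inf_le_right hb
    · rw [← inf_sup_left, hsup, inf_eq_left.mpr le_sup_right]
  · intro h a b c hba hac
    obtain ⟨p, hp, q, hq, rfl⟩ := h a c
    have hqa : a ⊓ q = ⊥ := inf_comm a q ▸ hq a le_rfl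
    refine ⟨b ⊔ q, ?_, ?_⟩
    · rw [inf_sup_left, hqa, sup_bot_eq, inf_eq_right.mpr hba]
    · rw [← sup_assoc, sup_eq_left.mpr hba]
      exact le_antisymm (sup_le hac le_sup_right) (sup_le_sup_right hp q)
end

section
/- Let X be a locally compact Hausdorff zero-dimensional space, let CK(X) be the lattice (with least element ∅) of compact clopen subsets of X ordered by inclusion, and let CO(X) be the Boolean algebra of clopen subsets of X. Then for every simple ideal J of CK(X), the union ⋃{F | F ∈ J} is a clopen subset of X, and the map Σ : Si(CK(X)) → CO(X), J ↦ ⋃{F | F ∈ J}, is an order isomorphism (hence a Boolean algebra isomorphism) from the set Si(CK(X)) of all simple ideals of CK(X), ordered by inclusion, onto CO(X). -/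
/-- The family of compact clopen subsets of a topological space. -/
def CK (X : Type*) [TopologicalSpace X] : Set (Set X) :=
  {s : Set X | IsCompact s ∧ IsClopen s}

/-- `J` is an ideal of the lattice `CK X` of compact clopen subsets (ordered by inclusion,
with least element `∅`): a nonempty lower subset of `CK X` closed under finite unions. -/
def IsIdealCK {X : Type*} [TopologicalSpace X] (J : Set (Set X)) : Prop :=
  J ⊆ CK X ∧ J.Nonempty ∧ (∀ s ∈ CK X, ∀ t ∈ J, s ⊆ t → s ∈ J) ∧
    ∀ s ∈ J, ∀ t ∈ J, s ∪ t ∈ J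

/-- `J` is a simple ideal of the lattice `CK X`: an ideal such that every element of `CK X`
is the union of a member of `J` and a member of the pseudocomplement of `J` in `CK X`. -/
def IsSimpleIdealCK {X : Type*} [TopologicalSpace X] (J : Set (Set X)) : Prop :=
  IsIdealCK J ∧ ∀ s ∈ CK X, ∃ a ∈ J, ∃ b ∈ CK X, (∀ t ∈ J, b ∩ t = ∅) ∧ s = a ∪ b

theorem exists_mem_CK_subset {X : Type*} [TopologicalSpace X] [T2Space X]
    [LocallyCompactSpace X]
    (hzd : TopologicalSpace.IsTopologicalBasis {s : Set X | IsClopen s})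
    {U : Set X} (hU : IsOpen U) {x : X} (hx : x ∈ U) : ∃ K ∈ CK X, x ∈ K ∧ K ⊆ U := by
  obtain ⟨C, hC, hxC, hCU⟩ := exists_compact_subset hU hx
  obtain ⟨V, hV, hxV, hVC⟩ := hzd.exists_subset_of_mem_open hxC isOpen_interior
  have hVC' := hVC.trans interior_subset
  exact ⟨V, ⟨hC.of_isClosed_subset hV.isClosed hVC', hV⟩, hxV, hVC'.trans hCU⟩

theorem IsIdealCK.mem_iff {X : Type*} [TopologicalSpace X] {J : Set (Set X)}
    (hJ : IsIdealCK J) {K : Set X} : K ∈ J ↔ K ∈ CK X ∧ K ⊆ ⋃₀ J := by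
  refine ⟨fun h => ⟨hJ.1 h, Set.subset_sUnion_of_mem h⟩, fun ⟨hK, hKJ⟩ => ?_⟩
  obtain ⟨hJK, ⟨t₀, ht₀⟩, hlow, hsup⟩ := hJ
  have hcover : ∃ t ∈ J, K ⊆ t := by
    refine hK.1.induction_on (p := fun s => ∃ t ∈ J, s ⊆ t) ⟨t₀, ht₀, Set.empty_subset _⟩
      (fun s s' hs ⟨t, ht, h⟩ => ⟨t, ht, hs.trans h⟩)
      (fun s s' ⟨t, ht, h⟩ ⟨t', ht', h'⟩ => ⟨_, hsup t ht t' ht', Set.union_subset_union h h'⟩)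
      fun x hx => ?_
    obtain ⟨t, ht, hxt⟩ := hKJ hx
    exact ⟨t, mem_nhdsWithin_of_mem_nhds ((hJK ht).2.isOpen.mem_nhds hxt), t, ht, subset_rfl⟩
  obtain ⟨t, ht, hKt⟩ := hcover
  exact hlow K hK t ht hKt

theorem IsSimpleIdealCK.isClopen_sUnion {X : Type*} [TopologicalSpace X] [T2Space X]
    [LocallyCompactSpace X]
    (hzd : TopologicalSpace.IsTopologicalBasis {s : Set X | IsClopen s})
    {J : Set (Set X)} (hJ : IsSimpleIdealCK J) : IsClopen (⋃₀ J) := by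
  refine ⟨⟨isOpen_iff_mem_nhds.2 fun x hx => ?_⟩,
    isOpen_sUnion fun t ht => (hJ.1.1 ht).2.isOpen⟩
  obtain ⟨K, hK, hxK, -⟩ := exists_mem_CK_subset hzd isOpen_univ (Set.mem_univ x)
  obtain ⟨a, ha, b, hb, hdisj, rfl⟩ := hJ.2 K hK
  have hxb : x ∈ b := hxK.resolve_left fun hxa => hx ⟨a, ha, hxa⟩
  refine Filter.mem_of_superset (hb.2.isOpen.mem_nhds hxb) ?_
  rintro y hyb ⟨t, ht, hyt⟩
  exact (hdisj t ht).subset ⟨hyb, hyt⟩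

theorem IsClopen.isSimpleIdealCK {X : Type*} [TopologicalSpace X] {U : Set X}
    (hU : IsClopen U) : IsSimpleIdealCK {s | s ∈ CK X ∧ s ⊆ U} := by
  refine ⟨⟨fun s hs => hs.1, ⟨∅, ⟨isCompact_empty, isClopen_empty⟩, Set.empty_subset _⟩,
    fun s hs t ht hst => ⟨hs, hst.trans ht.2⟩, fun s hs t ht =>
      ⟨⟨hs.1.1.union ht.1.1, hs.1.2.union ht.1.2⟩, Set.union_subset hs.2 ht.2⟩⟩, fun s hs => ?_⟩
  refine ⟨s ∩ U, ⟨⟨hs.1.inter_right hU.isClosed, hs.2.inter hU⟩, Set.inter_subset_right⟩,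
    s \ U, ⟨hs.1.diff hU.isOpen, hs.2.diff hU⟩, fun t ht => ?_, (Set.inter_union_sdiff s U).symm⟩
  exact Set.eq_empty_of_forall_notMem fun x hx => hx.1.2 (ht.2 hx.2)

theorem IsOpen.sUnion_CK_subset {X : Type*} [TopologicalSpace X] [T2Space X]
    [LocallyCompactSpace X]
    (hzd : TopologicalSpace.IsTopologicalBasis {s : Set X | IsClopen s})
    {U : Set X} (hU : IsOpen U) : ⋃₀ {s | s ∈ CK X ∧ s ⊆ U} = U := by
  refine (Set.sUnion_subset fun s hs => hs.2).antisymm fun x hx => ?_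
  obtain ⟨K, hK, hxK, hKU⟩ := exists_mem_CK_subset hzd hU hx
  exact ⟨K, ⟨hK, hKU⟩, hxK⟩

/-- (M. Stone) For a locally compact Hausdorff zero-dimensional space `X`, the union of any
simple ideal of `CK(X)` is clopen, and `J ↦ ⋃ J` is an order isomorphism from the simple
ideals of `CK(X)` (ordered by inclusion) onto the Boolean algebra `CO(X)` of clopen sets. -/
theorem stmt3 {X : Type*} [TopologicalSpace X] [T2Space X] [LocallyCompactSpace X]
    (hzd : TopologicalSpace.IsTopologicalBasis {s : Set X | IsClopen s}) :
    (∀ J : Set (Set X), IsSimpleIdealCK J → IsClopen (⋃₀ J)) ∧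
    ∃ e : {J : Set (Set X) // IsSimpleIdealCK J} ≃o {U : Set X // IsClopen U},
      ∀ J : {J : Set (Set X) // IsSimpleIdealCK J}, (e J).1 = ⋃₀ J.1 := by
  refine ⟨fun J hJ => hJ.isClopen_sUnion hzd, ?_⟩
  refine ⟨{ toFun := fun J => ⟨⋃₀ J.1, J.2.isClopen_sUnion hzd⟩
            invFun := fun U => ⟨{s | s ∈ CK X ∧ s ⊆ U.1}, U.2.isSimpleIdealCK⟩
            left_inv := fun J => Subtype.ext (Set.ext fun K => J.2.1.mem_iff.symm)
            right_inv := fun U => Subtype.ext (U.2.isOpen.sUnion_CK_subset hzd)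
            map_rel_iff' := ?_ }, fun J => rfl⟩
  intro J J'
  refine ⟨fun h K hK => ?_, fun h => Set.sUnion_subset_sUnion h⟩
  exact J'.2.1.mem_iff.2 ⟨J.2.1.1 hK, (Set.subset_sUnion_of_mem hK).trans h⟩
end

section
/- Let B be a Boolean algebra and let I be a dense ideal of B such that for every simple ideal J of the lattice I, the join ⋁_B J of the set J exists in B (i.e. (B, I) is a ZLB-algebra). Then the map Σ : Si(I) → B, J ↦ ⋁_B J, is an order isomorphism (hence a Boolean algebra isomorphism) from the set Si(I) of all simple ideals of I, ordered by inclusion, onto B. -/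
/-- A subset `I` of a lattice is an ideal: a nonempty lower set closed under finite joins. -/
def IsIdealSet {B : Type*} [Lattice B] (I : Set B) : Prop :=
  I.Nonempty ∧ (∀ a b : B, a ≤ b → b ∈ I → a ∈ I) ∧ ∀ a ∈ I, ∀ b ∈ I, a ⊔ b ∈ I

/-- `J` is an ideal of the sublattice `I`: a nonempty subset of `I`, lower within `I`,
closed under finite joins. -/
def IsIdealIn {B : Type*} [Lattice B] (I J : Set B) : Prop :=
  J ⊆ I ∧ J.Nonempty ∧ (∀ a ∈ I, ∀ b ∈ J, a ≤ b → a ∈ J) ∧ ∀ a ∈ J, ∀ b ∈ J, a ⊔ b ∈ J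

/-- `J` is a simple ideal of the lattice `I`: an ideal of `I` such that every element of `I`
is the join of an element of `J` and an element of the pseudocomplement of `J` in `I`. -/
def IsSimpleIdealIn {B : Type*} [Lattice B] [OrderBot B] (I J : Set B) : Prop :=
  IsIdealIn I J ∧ ∀ c ∈ I, ∃ a ∈ J, ∃ b ∈ I, (∀ t ∈ J, b ⊓ t = ⊥) ∧ c = a ⊔ b

/-- The elements of an ideal lying below `b` form a simple ideal of it. -/
theorem IsIdealSet.isSimpleIdealIn_inter_Iic {B : Type*} [BooleanAlgebra B] {I : Set B}
    (hI : IsIdealSet I) (b : B) : IsSimpleIdealIn I (I ∩ Set.Iic b) := by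
  obtain ⟨⟨x, hx⟩, hlow, hsup⟩ := hI
  refine ⟨⟨Set.inter_subset_left, ⟨⊥, hlow _ _ bot_le hx, bot_le⟩,
    fun a ha c hc hac => ⟨ha, hac.trans hc.2⟩,
    fun a ha c hc => ⟨hsup a ha.1 c hc.1, sup_le ha.2 hc.2⟩⟩, fun c hc => ?_⟩
  refine ⟨c ⊓ b, ⟨hlow _ _ inf_le_left hc, inf_le_right⟩, c \ b, hlow _ _ sdiff_le hc,
    fun t ht => ?_, (sup_inf_sdiff c b).symm⟩
  exact (disjoint_sdiff_self_left.mono_right ht.2).eq_bot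

/-- Every element of a Boolean algebra is the join of the elements of a dense subset below it. -/
theorem isLUB_inter_Iic_of_dense {B : Type*} [BooleanAlgebra B] {I : Set B}
    (hdense : ∀ a : B, a ≠ ⊥ → ∃ b ∈ I, b ≠ ⊥ ∧ b ≤ a) (b : B) :
    IsLUB (I ∩ Set.Iic b) b := by
  refine ⟨fun x hx => hx.2, fun u hu => ?_⟩
  by_contra h
  obtain ⟨d, hdI, hd, hdb⟩ := hdense (b \ u) (mt sdiff_eq_bot_iff.mp h)
  exact hd (disjoint_self.mp
    (disjoint_sdiff_self_left.mono hdb (hu ⟨hdI, hdb.trans sdiff_le⟩)))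

/-- A simple ideal of `I` with join `s` consists of the elements of `I` below `s`. -/
theorem IsSimpleIdealIn.eq_inter_Iic {B : Type*} [BooleanAlgebra B] {I J : Set B}
    (hJ : IsSimpleIdealIn I J) {s : B} (hs : IsLUB J s) : J = I ∩ Set.Iic s := by
  refine Set.Subset.antisymm (fun x hx => ⟨hJ.1.1 hx, hs.1 hx⟩) ?_
  rintro c ⟨hcI, hcs⟩
  obtain ⟨a, ha, b, -, hb, rfl⟩ := hJ.2 c hcI
  have hsb : s ≤ bᶜ :=
    hs.2 fun t ht => (disjoint_iff.mpr (hb t ht)).le_compl_left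
  have hbot : b = ⊥ := le_compl_self.mp ((le_sup_right.trans hcs).trans hsb)
  simpa [hbot] using ha

/-- For a ZLB-algebra `(B, I)`, the map `J ↦ ⋁_B J` is an order isomorphism from the
simple ideals of `I` (ordered by inclusion) onto `B`. -/
theorem stmt4 {B : Type*} [BooleanAlgebra B] (I : Set B) (hIdeal : IsIdealSet I)
    (hdense : ∀ a : B, a ≠ ⊥ → ∃ b ∈ I, b ≠ ⊥ ∧ b ≤ a)
    (hZLB : ∀ J : Set B, IsSimpleIdealIn I J → ∃ s : B, IsLUB J s) :
    ∃ e : {J : Set B // IsSimpleIdealIn I J} ≃o B,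
      ∀ J : {J : Set B // IsSimpleIdealIn I J}, IsLUB J.1 (e J) := by
  choose f hf using fun J : {J : Set B // IsSimpleIdealIn I J} => hZLB J.1 J.2
  refine ⟨⟨⟨f, fun b => ⟨I ∩ Set.Iic b, hIdeal.isSimpleIdealIn_inter_Iic b⟩,
    fun J => Subtype.ext (J.2.eq_inter_Iic (hf J)).symm,
    fun b => (hf _).unique (isLUB_inter_Iic_of_dense hdense b)⟩, ?_⟩, hf⟩
  intro J K
  refine ⟨fun h => ?_, fun h => (hf J).mono (hf K) h⟩
  change J.1 ⊆ K.1
  rw [J.2.eq_inter_Iic (hf J), K.2.eq_inter_Iic (hf K)]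
  exact Set.inter_subset_inter_right _ (Set.Iic_subset_Iic.mpr h)
end

section
/- If 𝓑 is a π-base of a topological space X, then there exists a π-base 𝓑′ of X such that 𝓑′ ⊆ 𝓑 and the cardinality of 𝓑′ equals the π-weight πw(X). -/
/-- A π-base of a topological space: a family of open sets such that every nonempty open
set contains a nonempty member of the family. -/
def IsPiBase {X : Type*} [TopologicalSpace X] (B : Set (Set X)) : Prop :=
  (∀ U ∈ B, IsOpen U) ∧ ∀ V : Set X, IsOpen V → V ≠ ∅ → ∃ U ∈ B, U ≠ ∅ ∧ U ⊆ V

/-- The π-weight of a topological space: the minimum cardinality of a π-base. -/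
noncomputable def piWeight (X : Type*) [TopologicalSpace X] : Cardinal :=
  ⨅ B : {B : Set (Set X) // IsPiBase B}, Cardinal.mk ↥B.1

/-- The π-weight is at most the cardinality of any π-base. -/
theorem IsPiBase.piWeight_le {X : Type*} [TopologicalSpace X] {B : Set (Set X)}
    (hB : IsPiBase B) : piWeight X ≤ Cardinal.mk ↥B :=
  ciInf_le' (fun B : {B : Set (Set X) // IsPiBase B} => Cardinal.mk ↥B.1) ⟨B, hB⟩

/-- The π-weight is attained as soon as some π-base is given. -/
theorem IsPiBase.exists_mk_eq_piWeight {X : Type*} [TopologicalSpace X] {B : Set (Set X)}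
    (hB : IsPiBase B) : ∃ C : Set (Set X), IsPiBase C ∧ Cardinal.mk ↥C = piWeight X := by
  have : Nonempty {B : Set (Set X) // IsPiBase B} := ⟨⟨B, hB⟩⟩
  obtain ⟨⟨C, hC⟩, hCw⟩ :=
    ciInf_mem (fun B : {B : Set (Set X) // IsPiBase B} => Cardinal.mk ↥B.1)
  exact ⟨C, hC, hCw⟩

/-- Every π-base contains a π-base of cardinality the π-weight of the space. -/
theorem stmt5 {X : Type*} [TopologicalSpace X] (𝓑 : Set (Set X)) (h : IsPiBase 𝓑) :
    ∃ 𝓑' ⊆ 𝓑, IsPiBase 𝓑' ∧ Cardinal.mk ↥𝓑' = piWeight X := by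
  obtain ⟨C, hC, hCw⟩ := h.exists_mk_eq_piWeight
  have hex : ∀ U : Set X, ∃ W, U ∈ C → U ≠ ∅ → W ∈ 𝓑 ∧ W ≠ ∅ ∧ W ⊆ U := by
    intro U
    by_cases hU : U ∈ C ∧ U ≠ ∅
    · obtain ⟨W, hW⟩ := h.2 U (hC.1 U hU.1) hU.2
      exact ⟨W, fun _ _ => hW⟩
    · exact ⟨∅, fun h₁ h₂ => absurd ⟨h₁, h₂⟩ hU⟩
  choose f hf using hex
  have hsub : f '' {U ∈ C | U ≠ ∅} ⊆ 𝓑 := by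
    rintro _ ⟨U, ⟨hUC, hU⟩, rfl⟩
    exact (hf U hUC hU).1
  have hbase : IsPiBase (f '' {U ∈ C | U ≠ ∅}) := by
    refine ⟨fun U hU => h.1 U (hsub hU), fun V hV hV' => ?_⟩
    obtain ⟨U, hUC, hU, hUV⟩ := hC.2 V hV hV'
    obtain ⟨-, hne, hfU⟩ := hf U hUC hU
    exact ⟨f U, ⟨U, ⟨hUC, hU⟩, rfl⟩, hne, hfU.trans hUV⟩
  refine ⟨_, hsub, hbase, le_antisymm ?_ hbase.piWeight_le⟩
  rw [← hCw]
  exact Cardinal.mk_image_le.trans (Cardinal.mk_le_mk_of_subset (Set.sep_subset C _))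
end

section
/- If X is a π-semiregular topological space, then the π-weight πw(X) of X equals the π-weight of the poset RC(X) of regular closed subsets of X, i.e. the minimum cardinality of a dense subset of RC(X). -/
/-- The closure of an open set is regular closed. -/
theorem IsOpen.closure_eq_closure_interior_closure {X : Type*} [TopologicalSpace X] {U : Set X}
    (hU : IsOpen U) : closure U = closure (interior (closure U)) :=
  (closure_mono (interior_maximal subset_closure hU)).antisymm
    (closure_minimal interior_subset isClosed_closure)

/-- The closures of the members of a π-base form a dense family of regular closed sets. -/
theorem IsPiBase.dense_image_closure {X : Type*} [TopologicalSpace X] {B : Set (Set X)}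
    (hB : IsPiBase B) :
    (∀ F ∈ closure '' B, F = closure (interior F)) ∧
      ∀ F : Set X, F = closure (interior F) → F ≠ ∅ → ∃ G ∈ closure '' B, G ≠ ∅ ∧ G ⊆ F := by
  refine ⟨?_, fun F hF hne => ?_⟩
  · rintro _ ⟨U, hU, rfl⟩
    exact (hB.1 U hU).closure_eq_closure_interior_closure
  · have hint : interior F ≠ ∅ := fun h => hne (by rw [hF, h, closure_empty])
    obtain ⟨U, hU, hU0, hUF⟩ := hB.2 _ isOpen_interior hint
    refine ⟨_, ⟨U, hU, rfl⟩, fun h => hU0 (closure_empty_iff U |>.1 h), ?_⟩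
    rw [hF]
    exact closure_mono hUF

/-- In a π-semiregular space, the interiors of the members of a dense family of regular closed
sets form a π-base. -/
theorem isPiBase_image_interior {X : Type*} [TopologicalSpace X]
    (hsr : IsPiBase {U : Set X | U = interior (closure U)}) {D : Set (Set X)}
    (hD : ∀ F ∈ D, F = closure (interior F))
    (hdense : ∀ F : Set X, F = closure (interior F) → F ≠ ∅ → ∃ G ∈ D, G ≠ ∅ ∧ G ⊆ F) :
    IsPiBase (interior '' D) := by
  refine ⟨?_, fun V hV hne => ?_⟩
  · rintro _ ⟨F, -, rfl⟩
    exact isOpen_interior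
  · obtain ⟨U, hU, hU0, hUV⟩ := hsr.2 V hV hne
    obtain ⟨G, hG, hG0, hGU⟩ := hdense (closure U)
      (hsr.1 U hU).closure_eq_closure_interior_closure
      (fun h => hU0 (closure_empty_iff U |>.1 h))
    refine ⟨_, ⟨G, hG, rfl⟩, fun h => hG0 (by rw [hD G hG, h, closure_empty]), ?_⟩
    refine (interior_mono hGU).trans ?_
    rw [← (show U = interior (closure U) from hU)]
    exact hUV

/-- For a π-semiregular space `X`, the π-weight of `X` equals the π-weight of the poset
`RC(X)` of regular closed sets, i.e. the minimum cardinality of a dense subset of `RC(X)`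
(a family `D` of regular closed sets such that every nonempty regular closed set contains
a nonempty member of `D`). -/
theorem stmt6 {X : Type*} [TopologicalSpace X]
    (hsr : IsPiBase {U : Set X | U = interior (closure U)}) :
    piWeight X =
      ⨅ D : {D : Set (Set X) // (∀ F ∈ D, F = closure (interior F)) ∧
          ∀ F : Set X, F = closure (interior F) → F ≠ ∅ → ∃ G ∈ D, G ≠ ∅ ∧ G ⊆ F},
        Cardinal.mk ↥D.1 := by
  apply le_antisymm
  · have : Nonempty {D : Set (Set X) // (∀ F ∈ D, F = closure (interior F)) ∧
        ∀ F : Set X, F = closure (interior F) → F ≠ ∅ → ∃ G ∈ D, G ≠ ∅ ∧ G ⊆ F} :=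
      ⟨⟨_, hsr.dense_image_closure⟩⟩
    exact le_ciInf fun D =>
      (ciInf_le' _ ⟨_, isPiBase_image_interior hsr D.2.1 D.2.2⟩).trans Cardinal.mk_image_le
  · have : Nonempty {B : Set (Set X) // IsPiBase B} := ⟨⟨_, hsr⟩⟩
    exact le_ciInf fun B =>
      (ciInf_le' _ ⟨_, B.2.dense_image_closure⟩).trans Cardinal.mk_image_le
end

section
/- Let A and B be Boolean algebras and φ : A → B a function satisfying: (1) φ(a ∨ b) = φ(a) ∨ φ(b) for all a, b ∈ A; (2) φ(0) = 0 and φ(a) = 1 implies a = 1; (3) the image φ(A) is dense in B. Then φ is an injective Boolean algebra homomorphism (it also preserves meets and complements), and the π-weight of A equals the π-weight of B. If moreover A is a complete Boolean algebra, then φ is a Boolean algebra isomorphism; conversely, every Boolean isomorphism satisfies (1)–(3). -/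
/-- The π-weight of a Boolean algebra: the minimum cardinality of a dense subset
(a set `D` such that every nonzero element lies above a nonzero element of `D`). -/
noncomputable def baPiWeight (A : Type*) [BooleanAlgebra A] : Cardinal :=
  ⨅ D : {D : Set A // ∀ a : A, a ≠ ⊥ → ∃ b ∈ D, b ≠ ⊥ ∧ b ≤ a}, Cardinal.mk ↥D.1

section JoinPreserving

variable {A B : Type*} [BooleanAlgebra A] [BooleanAlgebra B] {φ : A → B}

theorem monotone_of_map_sup (h1 : ∀ a b : A, φ (a ⊔ b) = φ a ⊔ φ b) : Monotone φ := by
  intro a b hab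
  rw [← sup_eq_right.2 hab, h1]
  exact le_sup_left

theorem map_top_of_map_sup_of_dense (h1 : ∀ a b : A, φ (a ⊔ b) = φ a ⊔ φ b)
    (h3 : ∀ b : B, b ≠ ⊥ → ∃ a : A, φ a ≠ ⊥ ∧ φ a ≤ b) : φ ⊤ = ⊤ := by
  by_contra h
  obtain ⟨a, ha, hle⟩ := h3 (φ ⊤)ᶜ (by simpa using h)
  exact ha (le_bot_iff.1 (disjoint_compl_right (monotone_of_map_sup h1 le_top) hle))

theorem map_compl_of_map_sup_of_dense (h1 : ∀ a b : A, φ (a ⊔ b) = φ a ⊔ φ b)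
    (h2a : φ ⊥ = ⊥) (h2b : ∀ a : A, φ a = ⊤ → a = ⊤)
    (h3 : ∀ b : B, b ≠ ⊥ → ∃ a : A, φ a ≠ ⊥ ∧ φ a ≤ b) (a : A) : φ aᶜ = (φ a)ᶜ := by
  have hmono := monotone_of_map_sup h1
  have hcod (x : A) : φ x ⊔ φ xᶜ = ⊤ := by
    rw [← h1, sup_compl_eq_top, map_top_of_map_sup_of_dense h1 h3]
  have hbot (d x : A) (hdx : d ≤ x) (hd : φ d ≤ φ xᶜ) : d = ⊥ := by
    refine compl_eq_top.1 (h2b _ ?_)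
    rw [← hcod d, right_eq_sup]
    exact hd.trans (hmono (compl_le_compl hdx))
  refine (IsCompl.compl_eq ⟨disjoint_iff.2 ?_, codisjoint_iff.2 (hcod a)⟩).symm
  by_contra h
  obtain ⟨c, hc, hle⟩ := h3 _ h
  have hca : c ⊓ a = ⊥ :=
    hbot _ a inf_le_right ((hmono inf_le_left).trans (hle.trans inf_le_right))
  have hca' : c ⊓ aᶜ = ⊥ := by
    refine hbot _ aᶜ inf_le_right ?_
    rw [compl_compl]
    exact (hmono inf_le_left).trans (hle.trans inf_le_left)
  apply hc
  rw [← h2a, ← inf_top_eq c, ← sup_compl_eq_top (x := a), inf_sup_left, hca, hca', sup_bot_eq]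

end JoinPreserving

section DenseEmbedding

theorem baPiWeight_eq_of_dense_orderEmbedding {A B : Type u} [BooleanAlgebra A]
    [BooleanAlgebra B] (φ : A ↪o B) (hbot : φ ⊥ = ⊥)
    (hdense : ∀ b : B, b ≠ ⊥ → ∃ a : A, φ a ≠ ⊥ ∧ φ a ≤ b) : baPiWeight A = baPiWeight B := by
  have hne (a : A) : φ a ≠ ⊥ ↔ a ≠ ⊥ := by rw [← hbot, φ.injective.ne_iff]
  apply le_antisymm
  · have : Nonempty {D : Set B // ∀ b : B, b ≠ ⊥ → ∃ d ∈ D, d ≠ ⊥ ∧ d ≤ b} :=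
      ⟨⟨Set.univ, fun b hb => ⟨b, trivial, hb, le_rfl⟩⟩⟩
    refine le_ciInf fun D => ?_
    have hex (b : B) : ∃ a : A, b ≠ ⊥ → φ a ≠ ⊥ ∧ φ a ≤ b := by
      by_cases hb : b = ⊥
      · exact ⟨⊥, fun h => absurd hb h⟩
      · obtain ⟨a, ha⟩ := hdense b hb
        exact ⟨a, fun _ => ha⟩
    choose f hf using hex
    refine (ciInf_le' _ ⟨f '' D.1, fun a ha => ?_⟩).trans Cardinal.mk_image_le
    obtain ⟨b, hbD, hb, hba⟩ := D.2 (φ a) ((hne a).2 ha)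
    exact ⟨f b, ⟨b, hbD, rfl⟩, (hne _).1 (hf b hb).1, φ.le_iff_le.1 ((hf b hb).2.trans hba)⟩
  · have : Nonempty {D : Set A // ∀ a : A, a ≠ ⊥ → ∃ d ∈ D, d ≠ ⊥ ∧ d ≤ a} :=
      ⟨⟨Set.univ, fun a ha => ⟨a, trivial, ha, le_rfl⟩⟩⟩
    refine le_ciInf fun D => ?_
    refine (ciInf_le' _ ⟨φ '' D.1, fun b hb => ?_⟩).trans Cardinal.mk_image_le
    obtain ⟨a, ha, hab⟩ := hdense b hb
    obtain ⟨d, hdD, hd, hda⟩ := D.2 a ((hne a).1 ha)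
    exact ⟨φ d, ⟨d, hdD, rfl⟩, (hne d).2 hd, (φ.monotone hda).trans hab⟩

theorem surjective_of_dense_orderEmbedding {A B : Type*} [BooleanAlgebra A]
    [BooleanAlgebra B] (φ : A ↪o B) (hbot : φ ⊥ = ⊥)
    (hdense : ∀ b : B, b ≠ ⊥ → ∃ a : A, φ a ≠ ⊥ ∧ φ a ≤ b)
    (hcomplete : ∀ S : Set A, ∃ s : A, IsLUB S s) : Function.Surjective φ := by
  intro b
  obtain ⟨s, hs⟩ := hcomplete {a | φ a ≤ b}
  refine ⟨s, le_antisymm ?_ ?_⟩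
  · by_contra h
    obtain ⟨c, hc, hle⟩ := hdense (φ s \ b) (by rwa [Ne, sdiff_eq_bot_iff])
    have hcs : c ≤ s := φ.le_iff_le.1 (hle.trans sdiff_le)
    have hsc : s ≤ cᶜ := by
      refine hs.2 fun a ha => le_compl_iff_disjoint_right.2 fun x hxa hxc => ?_
      refine φ.le_iff_le.1 ?_
      rw [hbot]
      exact disjoint_sdiff_self_right ((φ.monotone hxa).trans ha) ((φ.monotone hxc).trans hle)
    have : c = ⊥ := disjoint_self.1 (le_compl_iff_disjoint_right.1 (hcs.trans hsc))
    exact hc (by rw [this, hbot])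
  · by_contra h
    obtain ⟨c, hc, hle⟩ := hdense (b \ φ s) (by rwa [Ne, sdiff_eq_bot_iff])
    have hcs : c ≤ s := hs.1 (hle.trans sdiff_le)
    exact hc (le_bot_iff.1 (disjoint_sdiff_self_right (φ.monotone hcs) hle))

end DenseEmbedding


/-- If `φ : A → B` preserves joins, sends `0` to `0`, only `1` to `1`, and has dense image,
then `φ` is an injective Boolean homomorphism and `πw(A) = πw(B)`; if moreover `A` is
complete, then `φ` is an isomorphism. Conversely, every Boolean isomorphism satisfies
these three conditions. -/
theorem stmt7 {A B : Type u} [BooleanAlgebra A] [BooleanAlgebra B] (φ : A → B)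
    (h1 : ∀ a b : A, φ (a ⊔ b) = φ a ⊔ φ b)
    (h2a : φ ⊥ = ⊥) (h2b : ∀ a : A, φ a = ⊤ → a = ⊤)
    (h3 : ∀ b : B, b ≠ ⊥ → ∃ a : A, φ a ≠ ⊥ ∧ φ a ≤ b) :
    (Function.Injective φ ∧ (∀ a b : A, φ (a ⊓ b) = φ a ⊓ φ b) ∧
      (∀ a : A, φ aᶜ = (φ a)ᶜ) ∧ baPiWeight A = baPiWeight B ∧
      ((∀ S : Set A, ∃ s : A, IsLUB S s) → Function.Bijective φ)) ∧
    (∀ ψ : A ≃o B,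
      (∀ a b : A, ψ (a ⊔ b) = ψ a ⊔ ψ b) ∧ ψ ⊥ = ⊥ ∧
      (∀ a : A, ψ a = ⊤ → a = ⊤) ∧
      ∀ b : B, b ≠ ⊥ → ∃ a : A, ψ a ≠ ⊥ ∧ ψ a ≤ b) := by
  refine ⟨?_, fun ψ => ⟨map_sup ψ, map_bot ψ, fun a ha => (map_eq_top_iff ψ).1 ha,
    fun b hb => ⟨ψ.symm b, by simpa using hb, by simp⟩⟩⟩
  have hcompl := map_compl_of_map_sup_of_dense h1 h2a h2b h3
  have hinf (a b : A) : φ (a ⊓ b) = φ a ⊓ φ b := by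
    rw [← compl_compl (a ⊓ b), compl_inf, hcompl, h1, hcompl, hcompl, compl_sup, compl_compl,
      compl_compl]
  have hle (a b : A) : φ a ≤ φ b ↔ a ≤ b := by
    refine ⟨fun h => ?_, fun h => monotone_of_map_sup h1 h⟩
    have htop : aᶜ ⊔ b = ⊤ := by
      refine h2b _ ?_
      rw [h1, hcompl, ← top_le_iff, ← compl_sup_eq_top (x := φ a)]
      exact sup_le_sup_left h _
    rwa [← codisjoint_iff, codisjoint_iff_compl_le_right, compl_compl] at htop
  let e : A ↪o B := OrderEmbedding.ofMapLEIff φ hle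
  exact ⟨e.injective, hinf, hcompl, baPiWeight_eq_of_dense_orderEmbedding e h2a h3,
    fun hS => ⟨e.injective, surjective_of_dense_orderEmbedding e h2a h3 hS⟩⟩
end

section
/- Every MR-map is skeletal: if f : X → Y is a continuous map such that f(X) is dense in Y and int(f^♯(U)) ≠ ∅ for every nonempty regular open U ⊆ X, then int(cl(f(U))) ≠ ∅ for every nonempty open U ⊆ X. -/
/-- `f^♯(U) = {y | f⁻¹(y) ⊆ U}`. -/
def fSharp {X Y : Type*} (f : X → Y) (U : Set X) : Set Y :=
  {y : Y | f ⁻¹' {y} ⊆ U}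

/-- Every MR-map is skeletal. -/
theorem stmt10 {X Y : Type*} [TopologicalSpace X] [TopologicalSpace Y]
    (f : X → Y) (hf : Continuous f) (hd : Dense (Set.range f))
    (hmr : ∀ U : Set X, U = interior (closure U) → U ≠ ∅ → interior (fSharp f U) ≠ ∅) :
    ∀ U : Set X, IsOpen U → U ≠ ∅ → interior (closure (f '' U)) ≠ ∅ := by
  intro U hU hne
  have hW := hmr (interior (closure U)) interior_closure_idem.symm
    ((Set.nonempty_iff_ne_empty.2 hne).mono hU.subset_interior_closure).ne_empty
  refine ((Set.nonempty_iff_ne_empty.2 hW).mono (interior_maximal ?_ isOpen_interior)).ne_empty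
  refine (hd.open_subset_closure_inter isOpen_interior).trans
    (closure_minimal ?_ isClosed_closure)
  rintro _ ⟨hy, x, rfl⟩
  exact image_closure_subset_closure_image hf
    ⟨x, interior_subset (interior_subset hy rfl), rfl⟩
end

section
/- Let X be a π-semiregular topological space with πw(X) ≥ ℵ₀. Then there exists a compact Hausdorff zero-dimensional space Y with w(Y) = πw(X) such that the posets RC(X) and RC(Y) of regular closed subsets are order-isomorphic (equivalently, the Boolean algebras RC(X) and RC(Y) are isomorphic). -/
universe u

/-- The weight of a topological space: the minimum cardinality of a base of open sets. -/
noncomputable def tweight (X : Type*) [TopologicalSpace X] : Cardinal :=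
  ⨅ B : {B : Set (Set X) // TopologicalSpace.IsTopologicalBasis B}, Cardinal.mk ↥B.1

/-- The poset of regular closed subsets of `X`, ordered by inclusion. -/
abbrev RC (X : Type*) [TopologicalSpace X] := {F : Set X // F = closure (interior F)}

open Set TopologicalSpace Cardinal

section RegularClosed

variable {X Y P : Type*} [TopologicalSpace X] [TopologicalSpace Y]

/-- The regular closed subset of `Y` generated by the members of the family `V` whose
counterparts in the family `U` lie in `F`. -/
def rcTransfer (U : P → Set X) (V : P → Set Y) (hV : ∀ p, IsOpen (V p)) (F : Set X) : RC Y :=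
  ⟨closure (⋃ p ∈ {p | U p ⊆ F}, V p),
    subset_antisymm
      (closure_mono (interior_maximal subset_closure (isOpen_biUnion fun p _ => hV p)))
      (closure_minimal interior_subset isClosed_closure)⟩

theorem subset_rcTransfer_iff {U : P → Set X} {V : P → Set Y}
    (hU : IsPiBase (range U)) (hV : ∀ p, IsOpen (V p))
    (hUV : ∀ p q, Disjoint (U p) (U q) ↔ Disjoint (V p) (V q)) (F : RC X) (p : P) :
    V p ⊆ (rcTransfer U V hV F.1).1 ↔ U p ⊆ F.1 := by
  refine ⟨fun h => ?_, fun h => ?_⟩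
  · by_contra hp
    have hF : IsClosed F.1 := by rw [F.2]; exact isClosed_closure
    obtain ⟨_, ⟨q, rfl⟩, hne, hq⟩ := hU.2 (U p \ F.1) ((hU.1 _ ⟨p, rfl⟩).sdiff hF)
      (by rwa [Ne, sdiff_eq_empty])
    have hdisj : Disjoint (V q) (closure (⋃ p ∈ {p | U p ⊆ F.1}, V p)) := by
      refine Disjoint.closure_right ?_ (hV q)
      simp only [disjoint_iUnion_right]
      intro r hr
      rw [← hUV]
      exact disjoint_sdiff_left.mono hq hr
    have hdisj' := (hUV q p).2 (hdisj.mono_right h)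
    exact hne (disjoint_self.1 (hdisj'.mono_right (hq.trans sdiff_subset)))
  · exact (subset_biUnion_of_mem (u := V) (s := {p | U p ⊆ F.1}) h).trans subset_closure

theorem closure_biUnion_piBase {U : P → Set X} (hU : IsPiBase (range U)) (F : RC X) :
    closure (⋃ p ∈ {p | U p ⊆ F.1}, U p) = F.1 := by
  have hF : IsClosed F.1 := by rw [F.2]; exact isClosed_closure
  refine subset_antisymm (closure_minimal (iUnion₂_subset fun p hp => hp) hF) ?_
  conv_lhs => rw [F.2]
  refine closure_minimal ?_ isClosed_closure
  by_contra h
  obtain ⟨_, ⟨q, rfl⟩, hne, hq⟩ := hU.2 _ (isOpen_interior.sdiff isClosed_closure)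
    (by rwa [Ne, sdiff_eq_empty])
  have hsub : U q ⊆ closure (⋃ p ∈ {p | U p ⊆ F.1}, U p) :=
    (subset_biUnion_of_mem (u := U) (s := {p | U p ⊆ F.1})
      (hq.trans (sdiff_subset.trans interior_subset))).trans subset_closure
  exact hne (disjoint_self.1 (disjoint_sdiff_left.mono hq hsub))

theorem rcTransfer_rcTransfer {U : P → Set X} {V : P → Set Y}
    (hU : IsPiBase (range U)) (hV : ∀ p, IsOpen (V p))
    (hUV : ∀ p q, Disjoint (U p) (U q) ↔ Disjoint (V p) (V q)) (F : RC X) :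
    rcTransfer V U (fun p => hU.1 _ ⟨p, rfl⟩) (rcTransfer U V hV F.1).1 = F := by
  refine Subtype.ext (Eq.trans ?_ (closure_biUnion_piBase hU F))
  simp only [← subset_rcTransfer_iff hU hV hUV F]
  rfl

theorem rcTransfer_mono {X : Type*} (U : P → Set X) (V : P → Set Y) (hV : ∀ p, IsOpen (V p))
    {F G : Set X} (h : F ⊆ G) : rcTransfer U V hV F ≤ rcTransfer U V hV G :=
  closure_mono (biUnion_subset_biUnion_left fun _ hp => Subset.trans hp h)

/-- Two spaces with π-bases indexed by the same type, with the same disjointness relation,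
have isomorphic posets of regular closed sets. -/
def rcOrderIso {U : P → Set X} {V : P → Set Y}
    (hU : IsPiBase (range U)) (hV : IsPiBase (range V))
    (hUV : ∀ p q, Disjoint (U p) (U q) ↔ Disjoint (V p) (V q)) : RC X ≃o RC Y where
  toFun F := rcTransfer U V (fun p => hV.1 _ ⟨p, rfl⟩) F.1
  invFun G := rcTransfer V U (fun p => hU.1 _ ⟨p, rfl⟩) G.1
  left_inv F := rcTransfer_rcTransfer hU _ hUV F
  right_inv G := rcTransfer_rcTransfer hV _ (fun p q => (hUV p q).symm) G
  map_rel_iff' {F G} := by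
    have hV' : ∀ p, IsOpen (V p) := fun p => hV.1 _ ⟨p, rfl⟩
    refine ⟨fun h => ?_, fun h => rcTransfer_mono U V hV' h⟩
    rw [← rcTransfer_rcTransfer hU hV' hUV F, ← rcTransfer_rcTransfer hU hV' hUV G]
    exact rcTransfer_mono V U _ h

end RegularClosed

section PiWeight

variable {X : Type*} [TopologicalSpace X]

theorem piWeight_le_mk {B : Set (Set X)} (hB : IsPiBase B) : piWeight X ≤ #B :=
  ciInf_le' (fun B : {B : Set (Set X) // IsPiBase B} => #B.1) ⟨B, hB⟩

theorem isPiBase_isOpen : IsPiBase {U : Set X | IsOpen U} :=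
  ⟨fun _ h => h, fun V hV hne => ⟨V, hV, hne, subset_rfl⟩⟩

theorem exists_isPiBase_mk_eq (X : Type*) [TopologicalSpace X] :
    ∃ B : Set (Set X), IsPiBase B ∧ #B = piWeight X := by
  have : Nonempty {B : Set (Set X) // IsPiBase B} := ⟨⟨_, isPiBase_isOpen⟩⟩
  obtain ⟨B, hB⟩ := ciInf_mem fun B : {B : Set (Set X) // IsPiBase B} => #B.1
  exact ⟨B.1, B.2, hB⟩

theorem tweight_le_mk {B : Set (Set X)} (hB : IsTopologicalBasis B) : tweight X ≤ #B :=
  ciInf_le' (fun B : {B : Set (Set X) // IsTopologicalBasis B} => #B.1) ⟨B, hB⟩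

theorem IsPiBase.exists_subset_mk_le {B C : Set (Set X)} (hB : IsPiBase B) (hC : IsPiBase C) :
    ∃ D ⊆ C, IsPiBase D ∧ #D ≤ #B := by
  have h : ∀ b : {b : B // b.1 ≠ ∅}, ∃ c ∈ C, c ≠ ∅ ∧ c ⊆ b.1.1 :=
    fun b => hC.2 _ (hB.1 _ b.1.2) b.2
  choose f hfC hne hsub using h
  refine ⟨range f, range_subset_iff.2 hfC, ⟨?_, fun V hV hV0 => ?_⟩,
    mk_range_le.trans (mk_subtype_le _)⟩
  · rintro _ ⟨b, rfl⟩
    exact hC.1 _ (hfC b)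
  · obtain ⟨b, hb, hb0, hbV⟩ := hB.2 V hV hV0
    exact ⟨_, ⟨⟨⟨b, hb⟩, hb0⟩, rfl⟩, hne _, (hsub _).trans hbV⟩

theorem TopologicalSpace.IsTopologicalBasis.isPiBase {B : Set (Set X)}
    (hB : IsTopologicalBasis B) : IsPiBase B := by
  refine ⟨fun _ h => hB.isOpen h, fun V hV hne => ?_⟩
  obtain ⟨x, hx⟩ := nonempty_iff_ne_empty.2 hne
  obtain ⟨U, hU, hxU, hUV⟩ := hB.exists_subset_of_mem_open hx hV
  exact ⟨U, hU, Nonempty.ne_empty ⟨x, hxU⟩, hUV⟩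

end PiWeight

section SignSpace

variable {X ι : Type*} [TopologicalSpace X]

/-- The set `d i` itself or its exterior, according to the sign. -/
def signedSet (d : ι → Set X) (e : ι × Bool) : Set X :=
  if e.2 then d e.1 else (closure (d e.1))ᶜ

/-- The intersection of the signed sets in `p`. -/
def signedInter (d : ι → Set X) (p : Finset (ι × Bool)) : Set X :=
  ⋂ e ∈ p, signedSet d e

/-- The sign patterns all of whose finite parts have nonempty intersection; this is the Stone
space of the algebra of regular open sets generated by the `d i`. -/
def SignSpace (d : ι → Set X) : Set (ι → Bool) :=
  {y | ∀ p : Finset (ι × Bool), (∀ e ∈ p, y e.1 = e.2) → (signedInter d p).Nonempty}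

/-- The basic clopen set of sign patterns extending `p`. -/
def signCylinder (d : ι → Set X) (p : Finset (ι × Bool)) : Set (SignSpace d) :=
  {y | ∀ e ∈ p, y.1 e.1 = e.2}

theorem isOpen_forall_mem_apply_eq (p : Finset (ι × Bool)) :
    IsOpen {y : ι → Bool | ∀ e ∈ p, y e.1 = e.2} := by
  simp only [ofPred_forall]
  refine isOpen_biInter_finset fun e _ => ?_
  exact (isOpen_discrete {e.2}).preimage (f := fun y : ι → Bool => y e.1) (continuous_apply e.1)

variable (d : ι → Set X)

theorem isOpen_signCylinder (p : Finset (ι × Bool)) : IsOpen (signCylinder d p) :=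
  (isOpen_forall_mem_apply_eq p).preimage continuous_subtype_val

theorem isClosed_signSpace : IsClosed (SignSpace d) := by
  simp only [SignSpace, ofPred_forall]
  exact isClosed_iInter fun p => isClosed_imp (isOpen_forall_mem_apply_eq p) isClosed_const

instance : CompactSpace (SignSpace d) :=
  isCompact_iff_compactSpace.1 (isClosed_signSpace d).isCompact

theorem isTopologicalBasis_range_signCylinder :
    IsTopologicalBasis (range (signCylinder d)) := by
  classical
  refine isTopologicalBasis_of_isOpen_of_nhds ?_ fun y O hy hO => ?_
  · rintro _ ⟨p, rfl⟩
    exact isOpen_signCylinder d p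
  · obtain ⟨O', hO', rfl⟩ := isOpen_induced_iff.1 hO
    obtain ⟨I, u, hu, hIu⟩ := isOpen_pi_iff.1 hO' y.1 hy
    refine ⟨_, ⟨I.image fun i => (i, y.1 i), rfl⟩, ?_, fun z hz => hIu fun i hi => ?_⟩
    · simp [signCylinder]
    · have : z.1 i = y.1 i := hz (i, y.1 i) (Finset.mem_image_of_mem _ hi)
      rw [this]
      exact (hu i hi).2

theorem signedInter_union [DecidableEq ι] (p q : Finset (ι × Bool)) :
    signedInter d (p ∪ q) = signedInter d p ∩ signedInter d q := by
  ext x; simp only [signedInter, mem_iInter, Finset.mem_union, mem_inter_iff, or_imp, forall_and]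

theorem signCylinder_union [DecidableEq ι] (p q : Finset (ι × Bool)) :
    signCylinder d (p ∪ q) = signCylinder d p ∩ signCylinder d q := by
  ext x; simp only [signCylinder, Finset.mem_union, mem_inter_iff, or_imp, forall_and, mem_ofPred_eq]

/-- The filter of sets with dense interior. -/
def denseInteriorFilter (X : Type*) [TopologicalSpace X] : Filter X where
  sets := {s | Dense (interior s)}
  univ_sets := by simp
  sets_of_superset h hst := h.mono (interior_mono hst)
  inter_sets {s t} hs ht := by
    rw [mem_ofPred_eq, interior_inter]
    exact hs.inter_of_isOpen_left ht isOpen_interior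

variable {d}

theorem isOpen_signedSet (hd : ∀ i, IsOpen (d i)) (e : ι × Bool) : IsOpen (signedSet d e) := by
  unfold signedSet
  split_ifs
  exacts [hd _, isClosed_closure.isOpen_compl]

theorem isOpen_signedInter (hd : ∀ i, IsOpen (d i)) (p : Finset (ι × Bool)) :
    IsOpen (signedInter d p) :=
  isOpen_biInter_finset fun e _ => isOpen_signedSet hd e

theorem union_compl_closure_mem_denseInteriorFilter {U : Set X} (hU : IsOpen U) :
    U ∪ (closure U)ᶜ ∈ denseInteriorFilter X := by
  change Dense (interior _)
  rw [(hU.union isClosed_closure.isOpen_compl).interior_eq, dense_iff_closure_eq, closure_union]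
  exact univ_subset_iff.1 ((union_compl_self (closure U)).symm.subset.trans
    (union_subset_union_right _ subset_closure))

theorem signCylinder_nonempty_iff (hd : ∀ i, IsOpen (d i)) (p : Finset (ι × Bool)) :
    (signCylinder d p).Nonempty ↔ (signedInter d p).Nonempty := by
  classical
  refine ⟨fun ⟨y, hy⟩ => y.2 p hy, fun hp => ?_⟩
  have : (denseInteriorFilter X ⊓ Filter.principal (signedInter d p)).NeBot := by
    rw [Filter.inf_principal_neBot_iff]
    intro s (hs : Dense (interior s))
    rw [inter_comm]
    exact (hs.inter_open_nonempty _ (isOpen_signedInter hd p) hp).mono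
      (inter_subset_inter_right _ interior_subset)
  let G := Ultrafilter.of (denseInteriorFilter X ⊓ Filter.principal (signedInter d p))
  have hG := Ultrafilter.of_le (denseInteriorFilter X ⊓ Filter.principal (signedInter d p))
  have hpG : signedInter d p ∈ G := hG (Filter.mem_inf_of_right (Filter.mem_principal_self _))
  have hmem : ∀ e : ι × Bool, decide (d e.1 ∈ G) = e.2 ↔ signedSet d e ∈ G := by
    rintro ⟨i, b⟩
    have h : d i ∪ (closure (d i))ᶜ ∈ G :=
      hG (Filter.mem_inf_of_left (union_compl_closure_mem_denseInteriorFilter (hd i)))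
    cases b
    · simp only [signedSet, decide_eq_false_iff_not, Bool.false_eq_true, if_false]
      refine ⟨(Ultrafilter.union_mem_iff.1 h).resolve_left, fun h1 h2 => ?_⟩
      obtain ⟨x, hx⟩ := G.nonempty_of_mem (Filter.inter_mem h1 h2)
      exact hx.1 (subset_closure hx.2)
    · simp [signedSet]
  refine ⟨⟨fun i => decide (d i ∈ G), fun q hq => G.nonempty_of_mem ?_⟩, fun e he => ?_⟩
  · exact (Filter.biInter_finset_mem q).2 fun e he => (hmem e).1 (hq e he)
  · exact (hmem e).2 (Filter.mem_of_superset hpG (biInter_subset_of_mem he))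

theorem disjoint_signedInter_iff (hd : ∀ i, IsOpen (d i)) (p q : Finset (ι × Bool)) :
    Disjoint (signedInter d p) (signedInter d q) ↔
      Disjoint (signCylinder d p) (signCylinder d q) := by
  classical
  rw [← not_iff_not, not_disjoint_iff_nonempty_inter, not_disjoint_iff_nonempty_inter,
    ← signedInter_union, ← signCylinder_union, signCylinder_nonempty_iff hd]

theorem signedInter_singleton_true (i : ι) : signedInter d {(i, true)} = d i := by
  simp [signedInter, signedSet]

theorem isPiBase_range_signedInter (hd : IsPiBase (range d)) :
    IsPiBase (range (signedInter d)) := by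
  refine ⟨?_, fun V hV hne => ?_⟩
  · rintro _ ⟨p, rfl⟩
    exact isOpen_signedInter (fun i => hd.1 _ ⟨i, rfl⟩) p
  · obtain ⟨_, ⟨i, rfl⟩, h⟩ := hd.2 V hV hne
    exact ⟨_, ⟨{(i, true)}, signedInter_singleton_true i⟩, h⟩

theorem signedInter_subset_of_signCylinder_subset (hd : ∀ i, IsOpen (d i))
    (p : Finset (ι × Bool)) (i : ι) (hi : d i = interior (closure (d i)))
    (h : signCylinder d p ⊆ signCylinder d {(i, true)}) : signedInter d p ⊆ d i := by
  rw [hi]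
  refine interior_maximal ?_ (isOpen_signedInter hd p)
  have hdisj : Disjoint (signCylinder d p) (signCylinder d {(i, false)}) := by
    rw [disjoint_left]
    intro y hy hy'
    have h1 : y.1 i = true := h hy _ (Finset.mem_singleton_self _)
    have h2 : y.1 i = false := hy' _ (Finset.mem_singleton_self _)
    simp [h1] at h2
  rw [← disjoint_signedInter_iff hd] at hdisj
  simpa [signedInter, signedSet, disjoint_compl_right_iff_subset] using hdisj

theorem piWeight_le_tweight_signSpace {X ι : Type u} [TopologicalSpace X] {d : ι → Set X}
    (hd : IsPiBase (range d)) (hreg : ∀ i, d i = interior (closure (d i))) :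
    piWeight X ≤ tweight (SignSpace d) := by
  have hopen : ∀ i, IsOpen (d i) := fun i => hd.1 _ ⟨i, rfl⟩
  have : Nonempty {B : Set (Set (SignSpace d)) // IsTopologicalBasis B} :=
    ⟨⟨_, isTopologicalBasis_opens⟩⟩
  refine le_ciInf fun ⟨C, hC⟩ => ?_
  obtain ⟨D, hDV, hD, hDC⟩ :=
    hC.isPiBase.exists_subset_mk_le (isTopologicalBasis_range_signCylinder d).isPiBase
  choose f hf using fun c : D => hDV c.2
  refine (piWeight_le_mk (B := range (signedInter d ∘ f)) ⟨?_, fun O hO hO0 => ?_⟩).trans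
    (mk_range_le.trans hDC)
  · rintro _ ⟨c, rfl⟩
    exact isOpen_signedInter hopen _
  · obtain ⟨_, ⟨i, rfl⟩, hi0, hiO⟩ := hd.2 O hO hO0
    have hne : (signCylinder d {(i, true)}).Nonempty := by
      rwa [signCylinder_nonempty_iff hopen, signedInter_singleton_true, nonempty_iff_ne_empty]
    obtain ⟨c, hc, hc0, hci⟩ := hD.2 _ (isOpen_signCylinder d _) hne.ne_empty
    have hfc : signCylinder d (f ⟨c, hc⟩) = c := hf ⟨c, hc⟩
    refine ⟨_, ⟨⟨c, hc⟩, rfl⟩, ?_, ?_⟩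
    · rw [← nonempty_iff_ne_empty, Function.comp_apply, ← signCylinder_nonempty_iff hopen, hfc]
      exact nonempty_iff_ne_empty.2 hc0
    · exact (signedInter_subset_of_signCylinder_subset hopen _ i (hreg i)
        (hfc.symm ▸ hci)).trans hiO

theorem tweight_signSpace_le {X ι : Type u} [TopologicalSpace X] [Infinite ι] (d : ι → Set X) :
    tweight (SignSpace d) ≤ #ι := by
  refine (tweight_le_mk (isTopologicalBasis_range_signCylinder d)).trans (mk_range_le.trans ?_)
  rw [mk_finset_of_infinite, mk_prod, lift_uzero, mk_bool]
  simp [mul_eq_left (aleph0_le_mk ι) (ofNat_le_aleph0.trans (aleph0_le_mk ι))]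

end SignSpace

/-- For every π-semiregular space `X` of infinite π-weight there is a compact Hausdorff
zero-dimensional space `Y` with `w(Y) = πw(X)` and `RC(X)` order-isomorphic to `RC(Y)`. -/
theorem stmt12 {X : Type u} [TopologicalSpace X]
    (hsr : IsPiBase {U : Set X | U = interior (closure U)})
    (hpw : Cardinal.aleph0 ≤ piWeight X) :
    ∃ (Y : Type u) (tY : TopologicalSpace Y),
      @CompactSpace Y tY ∧ @T2Space Y tY ∧
      @TopologicalSpace.IsTopologicalBasis Y tY {s : Set Y | @IsClopen Y tY s} ∧
      @tweight Y tY = piWeight X ∧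
      Nonempty (RC X ≃o @RC Y tY) := by
  obtain ⟨B, hB, hBX⟩ := exists_isPiBase_mk_eq X
  obtain ⟨D, hDreg, hD, hDB⟩ := hB.exists_subset_mk_le hsr
  rw [hBX] at hDB
  let d : D → Set X := Subtype.val
  have hd : IsPiBase (range d) := by rwa [Subtype.range_coe]
  have : Infinite D := infinite_iff.2 (hpw.trans (piWeight_le_mk hD))
  exact ⟨SignSpace d, inferInstance, inferInstance, inferInstance,
    loc_compact_Haus_tot_disc_of_zero_dim,
    ((tweight_signSpace_le d).trans hDB).antisymm
      (piWeight_le_tweight_signSpace hd fun i => hDreg i.2),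
    ⟨rcOrderIso (isPiBase_range_signedInter hd)
      (isTopologicalBasis_range_signCylinder d).isPiBase
      (disjoint_signedInter_iff fun i => hd.1 _ ⟨i, rfl⟩)⟩⟩
end

section
/- Let f : X → Y be a continuous skeletal map. Then for every regular closed F ⊆ X, cl(f(F)) is regular closed in Y, and the map ψ : RC(X) → RC(Y), F ↦ cl(f(F)), is a left adjoint to the map φ : RC(Y) → RC(X), G ↦ cl(f⁻¹(int G)): ψ is order preserving, F ⊆ φ(ψ(F)) for every F ∈ RC(X), and ψ(φ(G)) ⊆ G for every G ∈ RC(Y); moreover ψ is the unique order-preserving map RC(X) → RC(Y) with these two properties. Equivalently, for all F ∈ RC(X) and G ∈ RC(Y): cl(f(F)) ⊆ G if and only if F ⊆ cl(f⁻¹(int G)). -/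
theorem Continuous.closure_image_subset_closure_interior {X Y : Type*} [TopologicalSpace X]
    [TopologicalSpace Y] {f : X → Y} (hf : Continuous f) {F : Set X} {G : Set Y}
    (h : F ⊆ closure (f ⁻¹' interior G)) : closure (f '' F) ⊆ closure (interior G) :=
  closure_minimal
    (Set.image_subset_iff.2 (h.trans (hf.closure_preimage_subset _))) isClosed_closure

/-- The unit of the adjunction induced by a skeletal map. -/
theorem subset_closure_preimage_interior_closure_image {X Y : Type*} [TopologicalSpace X]
    [TopologicalSpace Y] {f : X → Y}
    (hsk : ∀ U : Set X, IsOpen U → U ≠ ∅ → interior (closure (f '' U)) ≠ ∅)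
    {F : Set X} (hF : F = closure (interior F)) :
    F ⊆ closure (f ⁻¹' interior (closure (f '' F))) := by
  refine hF.subset.trans (closure_minimal (fun x hx => mem_closure_iff.2 fun V hV hxV => ?_)
    isClosed_closure)
  obtain ⟨y, hy⟩ := Set.nonempty_iff_ne_empty.2 <|
    hsk (V ∩ interior F) (hV.inter isOpen_interior) (Set.Nonempty.ne_empty ⟨x, hxV, hx⟩)
  obtain ⟨_, hzW, z, hz, rfl⟩ :=
    mem_closure_iff.1 (interior_subset hy) _ isOpen_interior hy
  exact ⟨z, hz.1, interior_mono (closure_mono (Set.image_mono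
    (Set.inter_subset_right.trans interior_subset))) hzW⟩

/-- For a continuous skeletal map `f : X → Y`, the map `ψ : RC(X) → RC(Y)`,
`F ↦ cl(f(F))`, is well defined, order preserving, and is the (unique) left adjoint to
`φ : RC(Y) → RC(X)`, `G ↦ cl(f⁻¹(int G))`. -/
theorem stmt14 {X Y : Type*} [TopologicalSpace X] [TopologicalSpace Y]
    (f : X → Y) (hf : Continuous f)
    (hsk : ∀ U : Set X, IsOpen U → U ≠ ∅ → interior (closure (f '' U)) ≠ ∅) :
    -- ψ maps regular closed sets to regular closed sets
    (∀ F : Set X, F = closure (interior F) →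
        closure (f '' F) = closure (interior (closure (f '' F)))) ∧
    -- ψ is order preserving
    (∀ F F' : Set X, F = closure (interior F) → F' = closure (interior F') →
        F ⊆ F' → closure (f '' F) ⊆ closure (f '' F')) ∧
    -- F ⊆ φ(ψ(F))
    (∀ F : Set X, F = closure (interior F) →
        F ⊆ closure (f ⁻¹' interior (closure (f '' F)))) ∧
    -- ψ(φ(G)) ⊆ G
    (∀ G : Set Y, G = closure (interior G) →
        closure (f '' closure (f ⁻¹' interior G)) ⊆ G) ∧
    -- ψ is the unique order-preserving map RC(X) → RC(Y) with these two properties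
    (∀ ψ' : Set X → Set Y,
        (∀ F : Set X, F = closure (interior F) → ψ' F = closure (interior (ψ' F))) →
        (∀ F F' : Set X, F = closure (interior F) → F' = closure (interior F') →
          F ⊆ F' → ψ' F ⊆ ψ' F') →
        (∀ F : Set X, F = closure (interior F) →
          F ⊆ closure (f ⁻¹' interior (ψ' F))) →
        (∀ G : Set Y, G = closure (interior G) →
          ψ' (closure (f ⁻¹' interior G)) ⊆ G) →
        ∀ F : Set X, F = closure (interior F) → ψ' F = closure (f '' F)) ∧
    -- equivalently, the adjunction: cl(f(F)) ⊆ G ↔ F ⊆ cl(f⁻¹(int G))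
    (∀ (F : Set X) (G : Set Y), F = closure (interior F) → G = closure (interior G) →
        (closure (f '' F) ⊆ G ↔ F ⊆ closure (f ⁻¹' interior G))) := by
  have unit := fun {F : Set X} (hF : F = closure (interior F)) =>
    subset_closure_preimage_interior_closure_image hsk hF
  have regular : ∀ F : Set X, F = closure (interior F) →
      closure (f '' F) = closure (interior (closure (f '' F))) := fun F hF =>
    (hf.closure_image_subset_closure_interior (unit hF)).antisymm
      (closure_minimal interior_subset isClosed_closure)
  have adj : ∀ (F : Set X) (G : Set Y), G = closure (interior G) →
      F ⊆ closure (f ⁻¹' interior G) → closure (f '' F) ⊆ G := fun F G hG h =>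
    (hf.closure_image_subset_closure_interior h).trans hG.superset
  refine ⟨regular, fun F F' _ _ h => closure_mono (Set.image_mono h), fun F hF => unit hF,
    fun G hG => adj _ G hG subset_rfl, fun ψ' hreg hmono hunit hcounit F hF => ?_,
    fun F G hF hG => ⟨fun h => ?_, adj F G hG⟩⟩
  · refine Set.Subset.antisymm ?_ (adj F _ (hreg F hF) (hunit F hF))
    exact (hmono F _ hF
      (isOpen_interior.preimage hf).closure_eq_closure_interior_closure (unit hF)).trans
      (hcounit _ (regular F hF))
  · exact (unit hF).trans (closure_mono (Set.preimage_mono (interior_mono h)))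
end

section
/- The absolute of a locally compact Hausdorff space is unique up to homeomorphism: if X is a locally compact Hausdorff space and Y₁, Y₂ are extremally disconnected completely regular Hausdorff (Tychonoff) spaces for which there exist perfect irreducible continuous maps f₁ : Y₁ → X and f₂ : Y₂ → X, then Y₁ and Y₂ are homeomorphic. -/
open Set in
/-- An irreducible closed continuous surjection from a Hausdorff space onto an extremally
disconnected space is injective. -/
theorem ExtremallyDisconnected.injective_of_irreducible {E A : Type*} [TopologicalSpace E]
    [TopologicalSpace A] [T2Space E] [ExtremallyDisconnected A] {f : E → A}
    (hf : Continuous f) (hcl : IsClosedMap f) (hs : Function.Surjective f)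
    (hirr : ∀ C : Set E, IsClosed C → C ≠ univ → f '' C ≠ univ) : Function.Injective f := by
  have mem_closure_of_mem {G : Set E} (hG : IsOpen G) {x : E} (hx : x ∈ G) :
      f x ∈ closure (f '' Gᶜ)ᶜ := by
    rw [mem_closure_iff]
    intro N hN hxN
    have hne : f '' (G ∩ f ⁻¹' N)ᶜ ≠ univ :=
      hirr _ (hG.inter (hN.preimage hf)).isClosed_compl (compl_ne_univ.mpr ⟨x, hx, hxN⟩)
    obtain ⟨a, ha⟩ := nonempty_compl.mpr hne
    obtain ⟨y, rfl⟩ := hs a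
    have hy : y ∈ G ∩ f ⁻¹' N := by
      by_contra h
      exact ha (mem_image_of_mem f h)
    exact ⟨f y, hy.2, fun h => ha (image_mono (compl_subset_compl.mpr inter_subset_left) h)⟩
  intro x₁ x₂ hx
  by_contra hne
  obtain ⟨G₁, G₂, hG₁, hG₂, hx₁, hx₂, hd⟩ := t2_separation hne
  have hdisj : Disjoint (f '' G₁ᶜ)ᶜ (f '' G₂ᶜ)ᶜ := by
    rw [disjoint_iff_inter_eq_empty, ← compl_union, ← image_union, ← compl_inter,
      disjoint_iff_inter_eq_empty.mp hd, compl_empty, compl_empty_iff,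
      image_univ_of_surjective hs]
  exact (ExtremallyDisconnected.disjoint_closure_of_disjoint_isOpen hdisj
    (hcl _ hG₁.isClosed_compl).isOpen_compl (hcl _ hG₂.isClosed_compl).isOpen_compl).ne_of_mem
    (mem_closure_of_mem hG₁ hx₁) (mem_closure_of_mem hG₂ hx₂) hx

open Set in
/-- A closed set whose fibers over a `T1` space are compact and nonempty contains a minimal closed
set meeting every fiber. -/
theorem exists_minimal_isClosed_image_eq_univ {Z A : Type*} [TopologicalSpace Z]
    [TopologicalSpace A] [T1Space A] {p : Z → A} (hp : Continuous p) {D : Set Z}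
    (hD : IsClosed D) (hsurj : p '' D = univ) (hcomp : ∀ a, IsCompact (D ∩ p ⁻¹' {a})) :
    ∃ E, Minimal (fun E => IsClosed E ∧ E ⊆ D ∧ p '' E = univ) E := by
  refine (zorn_superset_nonempty {E : Set Z | IsClosed E ∧ E ⊆ D ∧ p '' E = univ} ?_ D
    ⟨hD, subset_rfl, hsurj⟩).imp fun E hE => hE.2
  intro C hCS hC hCne
  obtain ⟨c₀, hc₀⟩ := hCne
  refine ⟨⋂₀ C, ⟨isClosed_sInter fun c hc => (hCS hc).1,
    (sInter_subset_of_mem hc₀).trans (hCS hc₀).2.1, ?_⟩, fun c hc => sInter_subset_of_mem hc⟩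
  refine eq_univ_of_forall fun a => ?_
  have : Nonempty C := ⟨⟨c₀, hc₀⟩⟩
  have hcl (c : C) : IsClosed (c.1 ∩ p ⁻¹' {a}) :=
    (hCS c.2).1.inter (isClosed_singleton.preimage hp)
  have hC' : IsChain (· ⊇ ·) C := hC.symm
  obtain ⟨z, hz⟩ := IsCompact.nonempty_iInter_of_directed_nonempty_isCompact_isClosed
    (fun c : C => c.1 ∩ p ⁻¹' {a})
    ((directedOn_iff_directed.mp hC'.directedOn).mono_comp (g := (· ∩ p ⁻¹' {a})) _
      fun _ _ => inter_subset_inter_left _)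
    (fun c => by
      obtain ⟨z, hz, hza⟩ : a ∈ p '' c.1 := by rw [(hCS c.2).2.2]; trivial
      exact ⟨z, hz, hza⟩)
    (fun c => (hcomp a).of_isClosed_subset (hcl c)
      (inter_subset_inter_left _ (hCS c.2).2.1))
    hcl
  rw [mem_iInter] at hz
  exact ⟨z, fun c hc => (hz ⟨c, hc⟩).1, (hz ⟨c₀, hc₀⟩).2⟩

open Set in
/-- The first projection from a fiber product along a proper map sends closed sets to closed
sets. -/
theorem IsProperMap.isClosed_image_fst_of_subset_pullback {X Y₁ Y₂ : Type*} [TopologicalSpace X]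
    [TopologicalSpace Y₁] [TopologicalSpace Y₂] {f₁ : Y₁ → X} {f₂ : Y₂ → X}
    (hf₁ : Continuous f₁) (hf₂ : IsProperMap f₂) {C : Set (Y₁ × Y₂)} (hC : IsClosed C)
    (hsub : C ⊆ {z | f₁ z.1 = f₂ z.2}) : IsClosed (Prod.fst '' C) := by
  have : Prod.fst '' C = (fun a => (a, f₁ a)) ⁻¹' (Prod.map id f₂ '' C) := by
    ext a
    constructor
    · rintro ⟨z, hz, rfl⟩
      exact ⟨z, hz, Prod.ext rfl (hsub hz).symm⟩
    · rintro ⟨z, hz, h⟩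
      exact ⟨z, hz, congrArg Prod.fst h⟩
  rw [this]
  exact ((isProperMap_id.prodMap hf₂).isClosedMap C hC).preimage (by fun_prop)

open Set in
/-- The second projection from a fiber product along a proper map sends closed sets to closed
sets. -/
theorem IsProperMap.isClosed_image_snd_of_subset_pullback {X Y₁ Y₂ : Type*} [TopologicalSpace X]
    [TopologicalSpace Y₁] [TopologicalSpace Y₂] {f₁ : Y₁ → X} {f₂ : Y₂ → X}
    (hf₁ : IsProperMap f₁) (hf₂ : Continuous f₂) {C : Set (Y₁ × Y₂)} (hC : IsClosed C)
    (hsub : C ⊆ {z | f₁ z.1 = f₂ z.2}) : IsClosed (Prod.snd '' C) := by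
  have := hf₁.isClosed_image_fst_of_subset_pullback hf₂ (hC.preimage continuous_swap)
    (fun z hz => (hsub hz).symm)
  rwa [← image_swap_eq_preimage_swap, image_image] at this


/-- The absolute of a locally compact Hausdorff space is unique up to homeomorphism:
any two extremally disconnected Tychonoff spaces admitting perfect irreducible continuous
maps onto `X` are homeomorphic. -/
theorem stmt15 {X Y₁ Y₂ : Type*} [TopologicalSpace X] [T2Space X] [LocallyCompactSpace X]
    [TopologicalSpace Y₁] [CompletelyRegularSpace Y₁] [T2Space Y₁]
    [ExtremallyDisconnected Y₁]
    [TopologicalSpace Y₂] [CompletelyRegularSpace Y₂] [T2Space Y₂]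
    [ExtremallyDisconnected Y₂]
    (f₁ : Y₁ → X) (f₂ : Y₂ → X)
    (hc₁ : Continuous f₁) (hcl₁ : IsClosedMap f₁)
    (hcomp₁ : ∀ x : X, IsCompact (f₁ ⁻¹' {x}))
    (hs₁ : Function.Surjective f₁)
    (hirr₁ : ∀ A : Set Y₁, IsClosed A → A ≠ Set.univ → f₁ '' A ≠ Set.univ)
    (hc₂ : Continuous f₂) (hcl₂ : IsClosedMap f₂)
    (hcomp₂ : ∀ x : X, IsCompact (f₂ ⁻¹' {x}))
    (hs₂ : Function.Surjective f₂)
    (hirr₂ : ∀ A : Set Y₂, IsClosed A → A ≠ Set.univ → f₂ '' A ≠ Set.univ) :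
    Nonempty (Y₁ ≃ₜ Y₂) := by
  have hp₁ : IsProperMap f₁ :=
    isProperMap_iff_isClosedMap_and_compact_fibers.mpr ⟨hc₁, hcl₁, fun x => hcomp₁ x⟩
  have hp₂ : IsProperMap f₂ :=
    isProperMap_iff_isClosedMap_and_compact_fibers.mpr ⟨hc₂, hcl₂, fun x => hcomp₂ x⟩
  let D : Set (Y₁ × Y₂) := {z | f₁ z.1 = f₂ z.2}
  have hD : IsClosed D := isClosed_eq (by fun_prop) (by fun_prop)
  have hDfst : Prod.fst '' D = Set.univ := Set.eq_univ_of_forall fun a =>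
    let ⟨b, hb⟩ := hs₂ (f₁ a)
    ⟨(a, b), hb.symm, rfl⟩
  have hDcomp (a : Y₁) : IsCompact (D ∩ Prod.fst ⁻¹' {a}) := by
    refine ((isCompact_singleton (x := a)).prod (hcomp₂ (f₁ a))).of_isClosed_subset
      (hD.inter (isClosed_singleton.preimage continuous_fst)) ?_
    rintro ⟨a', b⟩ ⟨h, rfl⟩
    exact ⟨rfl, Eq.symm h⟩
  obtain ⟨E, ⟨hE, hED, hE₁⟩, hmin⟩ :=
    exists_minimal_isClosed_image_eq_univ continuous_fst hD hDfst hDcomp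
  let q₁ : E → Y₁ := fun z => z.1.1
  let q₂ : E → Y₂ := fun z => z.1.2
  have hq (z : E) : f₁ (q₁ z) = f₂ (q₂ z) := hED z.2
  have hval {C : Set E} (hC : IsClosed C) : IsClosed (Subtype.val '' C) :=
    hE.isClosedMap_subtype_val C hC
  have hsub (C : Set E) : Subtype.val '' C ⊆ E := Subtype.coe_image_subset E C
  have hq₁c : Continuous q₁ := continuous_fst.comp continuous_subtype_val
  have hq₂c : Continuous q₂ := continuous_snd.comp continuous_subtype_val
  have hq₁cl : IsClosedMap q₁ := fun C hC => by
    have := hp₂.isClosed_image_fst_of_subset_pullback hc₁ (hval hC) ((hsub C).trans hED)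
    rwa [Set.image_image] at this
  have hq₂cl : IsClosedMap q₂ := fun C hC => by
    have := hp₁.isClosed_image_snd_of_subset_pullback hc₂ (hval hC) ((hsub C).trans hED)
    rwa [Set.image_image] at this
  have hq₁s : Function.Surjective q₁ := fun a => by
    obtain ⟨z, hz, rfl⟩ : a ∈ Prod.fst '' E := hE₁ ▸ Set.mem_univ a
    exact ⟨⟨z, hz⟩, rfl⟩
  have hq₁irr (C : Set E) (hC : IsClosed C) (hne : C ≠ Set.univ) : q₁ '' C ≠ Set.univ := by
    contrapose! hne
    refine Set.eq_univ_of_forall fun z => ?_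
    have hz := hmin ⟨hval hC, (hsub C).trans hED, by rwa [Set.image_image]⟩ (hsub C) z.2
    exact (Subtype.val_injective.mem_set_image).mp hz
  have himage (C : Set E) : f₁ '' (q₁ '' C) = f₂ '' (q₂ '' C) := by
    simp only [Set.image_image, hq]
  have hq₂s : Function.Surjective q₂ := by
    rw [← Set.range_eq_univ, ← Set.image_univ]
    by_contra h
    refine hirr₂ _ (hq₂cl _ isClosed_univ) h ?_
    rw [← himage, Set.image_univ, hq₁s.range_eq, Set.image_univ, hs₁.range_eq]
  have hq₂irr (C : Set E) (hC : IsClosed C) (hne : C ≠ Set.univ) : q₂ '' C ≠ Set.univ := by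
    intro h
    refine hirr₁ _ (hq₁cl C hC) (hq₁irr C hC hne) ?_
    rw [himage, h, Set.image_univ, hs₂.range_eq]
  have hq₁i := ExtremallyDisconnected.injective_of_irreducible hq₁c hq₁cl hq₁s hq₁irr
  have hq₂i := ExtremallyDisconnected.injective_of_irreducible hq₂c hq₂cl hq₂s hq₂irr
  exact ⟨((Equiv.ofBijective q₁ ⟨hq₁i, hq₁s⟩).toHomeomorphOfContinuousClosed hq₁c hq₁cl).symm.trans
    ((Equiv.ofBijective q₂ ⟨hq₂i, hq₂s⟩).toHomeomorphOfContinuousClosed hq₂c hq₂cl)⟩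
end

section
/- (Ponomarev's solution of Birkhoff's Problem 72.) A complete Boolean algebra A is isomorphic (as a Boolean algebra, equivalently order-isomorphic) to the poset RC(X) of regular closed subsets of some metrizable space X if and only if A has a σ-disjointed dense subset, i.e. a dense subset B of A with B = ⋃{Bₙ | n ∈ ℕ}, where for every n and every two distinct elements a, b ∈ Bₙ one has a ∧ b = 0. -/
universe u

section Antichain

variable {A : Type*} [SemilatticeInf A] [OrderBot A]

/-- Every set `S` of nonzero elements contains a pairwise disjoint family meeting each element
of `S`. -/
theorem exists_pairwise_disjoint_meeting (S : Set A) (hS : ⊥ ∉ S) :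
    ∃ D ⊆ S, (∀ a ∈ D, ∀ b ∈ D, a ≠ b → a ⊓ b = ⊥) ∧ ∀ s ∈ S, ∃ d ∈ D, d ⊓ s ≠ ⊥ := by
  obtain ⟨D, hD⟩ := zorn_subset
    {D : Set A | D ⊆ S ∧ ∀ a ∈ D, ∀ b ∈ D, a ≠ b → a ⊓ b = ⊥} (by
      intro c hc hchain
      refine ⟨⋃₀ c, ⟨Set.sUnion_subset fun D hD => (hc hD).1, ?_⟩,
        fun D hD => Set.subset_sUnion_of_mem hD⟩
      rintro a ⟨D, hD, haD⟩ b ⟨E, hE, hbE⟩ hab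
      rcases hchain.total hD hE with h | h
      · exact (hc hE).2 a (h haD) b hbE hab
      · exact (hc hD).2 a haD b (h hbE) hab)
  refine ⟨D, hD.prop.1, hD.prop.2, fun s hs => ?_⟩
  by_contra! hne
  have hins : insert s D ⊆ D := by
    refine hD.le_of_ge ⟨Set.insert_subset hs hD.prop.1, ?_⟩ (Set.subset_insert s D)
    rintro a (rfl | ha) b (rfl | hb) hab
    · exact absurd rfl hab
    · rw [inf_comm]; exact hne b hb
    · exact hne a ha
    · exact hD.prop.2 a ha b hb hab
  have h := hne s (hins (Set.mem_insert s D))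
  rw [inf_idem] at h
  exact hS (h ▸ hs)

end Antichain

section RegularClosed

variable {X : Type*} [TopologicalSpace X]

/-- The closure of an open set, as a regular closed set. -/
def RC.ofOpen (U : Set X) (hU : IsOpen U) : RC X :=
  ⟨closure U, (closure_mono (hU.subset_interior_iff.2 subset_closure)).antisymm
    (closure_minimal interior_subset isClosed_closure)⟩

theorem RC.isClosed (F : RC X) : IsClosed (F : Set X) := by
  rw [F.2]; exact isClosed_closure

end RegularClosed

section Forward

variable {A X : Type*} [BooleanAlgebra A] [MetricSpace X]

theorem OrderIso.apply_ne_empty_iff (e : A ≃o RC X) (a : A) :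
    (e a : Set X) ≠ ∅ ↔ a ≠ ⊥ := by
  refine not_congr ⟨fun h => ?_, ?_⟩
  · rw [← le_bot_iff, ← e.le_iff_le]
    change (e a : Set X) ⊆ e ⊥
    simp [h]
  · rintro rfl
    have h : e ⊥ ≤ RC.ofOpen (∅ : Set X) isOpen_empty := e.le_symm_apply.1 bot_le
    have h' : (e ⊥ : Set X) ⊆ closure ∅ := h
    simpa using h'

theorem exists_sigma_disjoint_dense (e : A ≃o RC X) :
    ∃ Bn : ℕ → Set A, (∀ a : A, a ≠ ⊥ → ∃ n, ∃ b ∈ Bn n, b ≠ ⊥ ∧ b ≤ a) ∧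
      ∀ n, ∀ a ∈ Bn n, ∀ b ∈ Bn n, a ≠ b → a ⊓ b = ⊥ := by
  have key := fun n : ℕ => exists_pairwise_disjoint_meeting
    {a : A | a ≠ ⊥ ∧ ∀ x ∈ (e a : Set X), ∀ y ∈ (e a : Set X), dist x y ≤ 2 * (1 / ((n : ℝ) + 1))}
    (fun h => h.1 rfl)
  choose D hDS hD hmeet using key
  refine ⟨D, fun a ha => ?_, hD⟩
  have hne : (interior (e a : Set X)).Nonempty := by
    rw [Set.nonempty_iff_ne_empty]
    intro h
    apply (e.apply_ne_empty_iff a).2 ha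
    rw [(e a).2, h, closure_empty]
  obtain ⟨x, hx⟩ := hne
  obtain ⟨ε, hε, hball⟩ := Metric.isOpen_iff.1 isOpen_interior x hx
  obtain ⟨n, hn⟩ := exists_nat_one_div_lt (show (0 : ℝ) < ε / 3 by positivity)
  have hpos : (0 : ℝ) < 1 / ((n : ℝ) + 1) := by positivity
  set r : ℝ := 1 / ((n : ℝ) + 1)
  set c : A := e.symm (RC.ofOpen (Metric.ball x r) Metric.isOpen_ball)
  have hec : (e c : Set X) = closure (Metric.ball x r) := by simp [c, RC.ofOpen]
  have hecb : (e c : Set X) ⊆ Metric.closedBall x r := hec ▸ Metric.closure_ball_subset_closedBall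
  have hxc : x ∈ (e c : Set X) := hec ▸ subset_closure (Metric.mem_ball_self hpos)
  obtain ⟨d, hdD, hdc⟩ := hmeet n c
    ⟨(e.apply_ne_empty_iff c).1 (Set.nonempty_iff_ne_empty.1 ⟨x, hxc⟩),
    fun y hy z hz => by
      have h1 : dist y x ≤ r := hecb hy
      have h2 : dist z x ≤ r := hecb hz
      linarith [dist_triangle_right y z x]⟩
  refine ⟨n, d, hdD, (hDS n hdD).1, ?_⟩
  obtain ⟨y, hy⟩ := Set.nonempty_iff_ne_empty.2 ((e.apply_ne_empty_iff _).2 hdc)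
  have hyd : y ∈ (e d : Set X) := e.monotone inf_le_left hy
  have hyc : dist y x ≤ r := hecb (e.monotone inf_le_right hy)
  rw [← e.le_iff_le]
  intro z hz
  refine interior_subset (hball ?_)
  have h1 := (hDS n hdD).2 z hz y hyd
  rw [Metric.mem_ball]
  linarith [dist_triangle z y x]

end Forward

section Branches

variable {A : Type u} [CompleteBooleanAlgebra A]

/-- The sequences choosing one element from each `P n` with all finite meets nonzero. -/
def BranchSpace (P : ℕ → Set A) : Type u :=
  {x : ℕ → A // (∀ n, x n ∈ P n) ∧ ∀ n, (Finset.range n).inf x ≠ ⊥}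

namespace BranchSpace

/-- The topology of pointwise convergence, for the discrete topology on `A`. -/
instance (P : ℕ → Set A) : TopologicalSpace (BranchSpace P) :=
  letI : TopologicalSpace A := ⊥
  inferInstanceAs (TopologicalSpace {_x : ℕ → A // _})

instance (P : ℕ → Set A) : TopologicalSpace.MetrizableSpace (BranchSpace P) := by
  let : TopologicalSpace A := ⊥
  have : DiscreteTopology A := ⟨rfl⟩
  let : MetricSpace (ℕ → A) := PiNat.metricSpace (E := fun _ => A)
  exact Topology.IsEmbedding.subtypeVal.metrizableSpace

variable {P : ℕ → Set A}

/-- The set of branches agreeing with `x` below `n`. -/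
def cyl (x : BranchSpace P) (n : ℕ) : Set (BranchSpace P) := {y | ∀ i < n, y.1 i = x.1 i}

/-- The meet of the first `n` entries of a branch. -/
def meet (x : BranchSpace P) (n : ℕ) : A := (Finset.range n).inf x.1

theorem meet_ne_bot (x : BranchSpace P) (n : ℕ) : x.meet n ≠ ⊥ := x.2.2 n

theorem meet_anti (x : BranchSpace P) {m n : ℕ} (h : m ≤ n) : x.meet n ≤ x.meet m :=
  Finset.inf_mono (Finset.range_mono h)

theorem meet_le (x : BranchSpace P) {i n : ℕ} (h : i < n) : x.meet n ≤ x.1 i :=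
  Finset.inf_le (Finset.mem_range.2 h)

theorem mem_cyl_self (x : BranchSpace P) (n : ℕ) : x ∈ x.cyl n := fun _ _ => rfl

theorem meet_eq_of_mem_cyl {x y : BranchSpace P} {n : ℕ} (h : y ∈ x.cyl n) :
    y.meet n = x.meet n :=
  Finset.inf_congr rfl fun i hi => h i (Finset.mem_range.1 hi)

theorem isOpen_cyl (x : BranchSpace P) (n : ℕ) : IsOpen (x.cyl n) := by
  let : TopologicalSpace A := ⊥
  have : DiscreteTopology A := ⟨rfl⟩
  have h : IsOpen (PiNat.cylinder (E := fun _ => A) x.1 n) := PiNat.isOpen_cylinder _ _ _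
  exact h.preimage continuous_subtype_val

theorem exists_cyl_subset {U : Set (BranchSpace P)} (hU : IsOpen U) {x : BranchSpace P}
    (hx : x ∈ U) : ∃ n, x.cyl n ⊆ U := by
  let : TopologicalSpace A := ⊥
  have : DiscreteTopology A := ⟨rfl⟩
  obtain ⟨V, hV, rfl⟩ := isOpen_induced_iff.1 hU
  obtain ⟨_, ⟨y, n, rfl⟩, hy, hsub⟩ :=
    (PiNat.isTopologicalBasis_cylinders fun _ => A).exists_subset_of_mem_open hx hV
  refine ⟨n, fun z hz => hsub ?_⟩
  exact fun i hi => (hz i hi).trans (hy i hi)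

theorem mem_closure_iff_cyl {S : Set (BranchSpace P)} {x : BranchSpace P} :
    x ∈ closure S ↔ ∀ n, (x.cyl n ∩ S).Nonempty := by
  rw [mem_closure_iff]
  refine ⟨fun h n => h _ (x.isOpen_cyl n) (x.mem_cyl_self n), fun h U hU hx => ?_⟩
  obtain ⟨n, hn⟩ := exists_cyl_subset hU hx
  exact (h n).mono (Set.inter_subset_inter_left _ hn)

theorem mem_cyl_of_meet_le (hd : ∀ n, ∀ a ∈ P n, ∀ b ∈ P n, a ≠ b → a ⊓ b = ⊥)
    {x y : BranchSpace P} {k n : ℕ} (h : y.meet k ≤ x.meet n) : y ∈ x.cyl n := by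
  intro i hi
  by_contra hne
  refine y.meet_ne_bot (max k (i + 1)) (le_bot_iff.1 ?_)
  rw [← hd i _ (y.2.1 i) _ (x.2.1 i) hne]
  exact le_inf (y.meet_le (by omega))
    ((y.meet_anti (le_max_left _ _)).trans (h.trans (x.meet_le hi)))

theorem exists_meet_inf_ne_bot (hc : ∀ n, ∀ c : A, c ≠ ⊥ → ∃ p ∈ P n, c ⊓ p ≠ ⊥) {c : A}
    (hne : c ≠ ⊥) : ∃ x : BranchSpace P, ∀ n, x.meet n ⊓ c ≠ ⊥ := by
  choose g hgP hg using hc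
  let s : ℕ → {c : A // c ≠ ⊥} := fun n =>
    Nat.rec ⟨c, hne⟩ (fun n c => ⟨c.1 ⊓ g n c.1 c.2, hg n c.1 c.2⟩) n
  let x : ℕ → A := fun n => g n (s n).1 (s n).2
  have hs : ∀ n, (Finset.range n).inf x ⊓ c = (s n).1 := by
    intro n
    induction n with
    | zero => simp [s]
    | succ n ih =>
      rw [Finset.range_add_one, Finset.inf_insert, inf_assoc, ih, inf_comm]
  have hx : ∀ n, (Finset.range n).inf x ⊓ c ≠ ⊥ := fun n => hs n ▸ (s n).2
  exact ⟨⟨x, fun n => hgP n _ _, fun n h => hx n (by rw [h, bot_inf_eq])⟩, hx⟩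

theorem exists_meet_le (hd : ∀ n, ∀ a ∈ P n, ∀ b ∈ P n, a ≠ b → a ⊓ b = ⊥)
    (hc : ∀ n, ∀ c : A, c ≠ ⊥ → ∃ p ∈ P n, c ⊓ p ≠ ⊥)
    (hP : ∀ a : A, a ≠ ⊥ → ∃ n, ∃ b ∈ P n, b ≠ ⊥ ∧ b ≤ a) {a : A} (ha : a ≠ ⊥) :
    ∃ (x : BranchSpace P) (n : ℕ), x.meet n ≤ a := by
  obtain ⟨n, b, hb, hb0, hba⟩ := hP a ha
  obtain ⟨x, hx⟩ := exists_meet_inf_ne_bot hc hb0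
  refine ⟨x, n + 1, (x.meet_le n.lt_succ_self).trans (le_trans (le_of_eq ?_) hba)⟩
  by_contra hne
  refine hx (n + 1) (le_bot_iff.1 ?_)
  rw [← hd n _ (x.2.1 n) _ hb hne]
  exact inf_le_inf_right b (x.meet_le n.lt_succ_self)

/-- The branches one of whose finite meets lies below `a`. -/
def openOf (P : ℕ → Set A) (a : A) : Set (BranchSpace P) := {x | ∃ n, x.meet n ≤ a}

theorem isOpen_openOf (a : A) : IsOpen (openOf P a) := by
  refine isOpen_iff_forall_mem_open.2 fun x ⟨n, hn⟩ => ⟨x.cyl n, fun y hy => ⟨n, ?_⟩,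
    x.isOpen_cyl n, x.mem_cyl_self n⟩
  rwa [meet_eq_of_mem_cyl hy]

theorem mem_closure_openOf (hd : ∀ n, ∀ a ∈ P n, ∀ b ∈ P n, a ≠ b → a ⊓ b = ⊥)
    (hm : ∀ a : A, a ≠ ⊥ → ∃ (x : BranchSpace P) (n : ℕ), x.meet n ≤ a)
    {a : A} {x : BranchSpace P} :
    x ∈ closure (openOf P a) ↔ ∀ n, x.meet n ⊓ a ≠ ⊥ := by
  rw [mem_closure_iff_cyl]
  refine forall_congr' fun n => ⟨?_, fun h => ?_⟩
  · rintro ⟨y, hy, k, hk⟩ h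
    refine y.meet_ne_bot (max n k) (le_bot_iff.1 ?_)
    rw [← h, ← meet_eq_of_mem_cyl hy]
    exact le_inf (y.meet_anti (le_max_left _ _)) ((y.meet_anti (le_max_right _ _)).trans hk)
  · obtain ⟨y, k, hy⟩ := hm _ h
    exact ⟨y, mem_cyl_of_meet_le hd (hy.trans inf_le_left), k, hy.trans inf_le_right⟩

theorem closure_openOf_subset_iff (hd : ∀ n, ∀ a ∈ P n, ∀ b ∈ P n, a ≠ b → a ⊓ b = ⊥)
    (hm : ∀ a : A, a ≠ ⊥ → ∃ (x : BranchSpace P) (n : ℕ), x.meet n ≤ a) {a b : A} :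
    closure (openOf P a) ⊆ closure (openOf P b) ↔ a ≤ b := by
  refine ⟨fun h => ?_, fun h => closure_mono fun x ⟨n, hn⟩ => ⟨n, hn.trans h⟩⟩
  by_contra hab
  have hne : a ⊓ bᶜ ≠ ⊥ := fun h0 => hab (by rwa [← sdiff_eq, sdiff_eq_bot_iff] at h0)
  obtain ⟨x, n, hx⟩ := hm _ hne
  have hxb := h (subset_closure ⟨n, hx.trans inf_le_left⟩)
  refine (mem_closure_openOf hd hm).1 hxb n (le_bot_iff.1 ?_)
  rw [← compl_inf_self b]
  exact inf_le_inf_right b (hx.trans inf_le_right)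

theorem exists_closure_openOf_eq (hd : ∀ n, ∀ a ∈ P n, ∀ b ∈ P n, a ≠ b → a ⊓ b = ⊥)
    (hm : ∀ a : A, a ≠ ⊥ → ∃ (x : BranchSpace P) (n : ℕ), x.meet n ≤ a)
    (F : RC (BranchSpace P)) : ∃ a : A, closure (openOf P a) = F := by
  let S : Set A := {m | ∃ (x : BranchSpace P) (n : ℕ), x.cyl n ⊆ F ∧ x.meet n = m}
  refine ⟨sSup S, Set.Subset.antisymm (fun x hx => ?_) ?_⟩
  · rw [← F.isClosed.closure_eq, mem_closure_iff_cyl]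
    intro n
    have h := (mem_closure_openOf hd hm).1 hx n
    rw [inf_sSup_eq] at h
    have : ∃ m ∈ S, x.meet n ⊓ m ≠ ⊥ := by
      by_contra! h0
      exact h (by simpa using h0)
    obtain ⟨_, ⟨y, k, hyF, rfl⟩, hne⟩ := this
    obtain ⟨z, j, hz⟩ := hm _ hne
    exact ⟨z, mem_cyl_of_meet_le hd (hz.trans inf_le_left),
      hyF (mem_cyl_of_meet_le hd (hz.trans inf_le_right))⟩
  · conv_lhs => rw [F.2]
    refine closure_mono fun x hx => ?_
    obtain ⟨n, hn⟩ := exists_cyl_subset isOpen_interior hx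
    exact ⟨n, le_sSup ⟨x, n, hn.trans interior_subset, rfl⟩⟩

theorem nonempty_orderIso (hd : ∀ n, ∀ a ∈ P n, ∀ b ∈ P n, a ≠ b → a ⊓ b = ⊥)
    (hm : ∀ a : A, a ≠ ⊥ → ∃ (x : BranchSpace P) (n : ℕ), x.meet n ≤ a) :
    Nonempty (A ≃o RC (BranchSpace P)) := by
  let f : A ↪o RC (BranchSpace P) := OrderEmbedding.ofMapLEIff
    (fun a => RC.ofOpen (openOf P a) (isOpen_openOf a)) fun a b => closure_openOf_subset_iff hd hm
  refine ⟨RelIso.ofSurjective f fun F => ?_⟩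
  obtain ⟨a, ha⟩ := exists_closure_openOf_eq hd hm F
  exact ⟨a, Subtype.ext ha⟩

end BranchSpace

theorem insert_compl_sSup_disjoint {B : Set A}
    (hB : ∀ a ∈ B, ∀ b ∈ B, a ≠ b → a ⊓ b = ⊥) :
    ∀ a ∈ insert (sSup B)ᶜ B, ∀ b ∈ insert (sSup B)ᶜ B, a ≠ b → a ⊓ b = ⊥ := by
  have h : ∀ b ∈ B, (sSup B)ᶜ ⊓ b = ⊥ := fun b hb =>
    (disjoint_compl_left.mono_right (le_sSup hb)).eq_bot
  rintro a (rfl | ha) b (rfl | hb) hab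
  · exact absurd rfl hab
  · exact h b hb
  · rw [inf_comm]; exact h a ha
  · exact hB a ha b hb hab

theorem exists_insert_compl_sSup_inf_ne_bot (B : Set A) {c : A} (hc : c ≠ ⊥) :
    ∃ p ∈ insert (sSup B)ᶜ B, c ⊓ p ≠ ⊥ := by
  by_contra! h
  have h1 : c ⊓ (sSup B)ᶜ = ⊥ := h _ (Set.mem_insert _ _)
  have h2 : c ⊓ sSup B = ⊥ := by
    rw [inf_sSup_eq]
    simpa using fun b hb => h b (Set.mem_insert_of_mem _ hb)
  apply hc
  rw [← inf_top_eq c, ← sup_compl_eq_top (x := sSup B), inf_sup_left, h1, h2, sup_bot_eq]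

end Branches

/-- (Ponomarev's solution of Birkhoff's Problem 72) A complete Boolean algebra `A` is
isomorphic to `RC(X)` for some metrizable space `X` iff `A` has a σ-disjointed dense
subset. -/
theorem stmt18 {A : Type u} [CompleteBooleanAlgebra A] :
    (∃ (X : Type u) (tX : TopologicalSpace X),
        @TopologicalSpace.MetrizableSpace X tX ∧ Nonempty (A ≃o @RC X tX)) ↔
    ∃ B : Set A, (∀ a : A, a ≠ ⊥ → ∃ b ∈ B, b ≠ ⊥ ∧ b ≤ a) ∧
      ∃ Bn : ℕ → Set A, (B = ⋃ n : ℕ, Bn n) ∧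
        ∀ n : ℕ, ∀ a ∈ Bn n, ∀ b ∈ Bn n, a ≠ b → a ⊓ b = ⊥ := by
  constructor
  · rintro ⟨X, tX, hX, ⟨e⟩⟩
    let := TopologicalSpace.metrizableSpaceMetric X
    obtain ⟨Bn, hdense, hdisj⟩ := exists_sigma_disjoint_dense e
    refine ⟨⋃ n, Bn n, fun a ha => ?_, Bn, rfl, hdisj⟩
    obtain ⟨n, b, hb, hb'⟩ := hdense a ha
    exact ⟨b, Set.mem_iUnion_of_mem n hb, hb'⟩
  · rintro ⟨_, hdense, Bn, rfl, hdisj⟩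
    have hd := fun n => insert_compl_sSup_disjoint (hdisj n)
    refine ⟨BranchSpace fun n => insert (sSup (Bn n))ᶜ (Bn n), inferInstance, inferInstance,
      BranchSpace.nonempty_orderIso hd fun a ha => BranchSpace.exists_meet_le hd
        (fun n c hc => exists_insert_compl_sSup_inf_ne_bot (Bn n) hc) (fun a ha => ?_) ha⟩
    obtain ⟨b, hb, hb'⟩ := hdense a ha
    obtain ⟨n, hn⟩ := Set.mem_iUnion.1 hb
    exact ⟨n, b, Set.mem_insert_of_mem _ hn, hb'⟩
end
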